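/- arXiv:2512.08837 — 3 statements merged into one kernel-verified Lean document; each statement's English description precedes it below -/
import Mathlib

section
/- Let 1 ≤ ℓ ≤ k−1 with k−ℓ not dividing k, and let m ≥ ⌈k/(k−ℓ)⌉. Then the k-uniform ℓ-cycle C with exactly k²ℓ + m edges (hence (k²ℓ+m)(k−ℓ) vertices) is k-partite. Moreover, if m = ⌈k/(k−ℓ)⌉, then gcd(C) = 1. -/
/-- The canonical `k`-uniform `ℓ`-cycle on vertex set `ZMod m`: its edges are the
`m / (k - ℓ)` sets of `k` cyclically consecutive vertices whose starting points are
the multiples of `k - ℓ`.  For `(k - ℓ) ∣ m` and `2 * k - ℓ ≤ m` this is a genuine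
`ℓ`-cycle: consecutive edges intersect in exactly `ℓ` vertices. -/
def cycleGraph (k ℓ m : ℕ) : Finset (Finset (ZMod m)) :=
  (Finset.range (m / (k - ℓ))).image
    (fun i => Finset.image (fun j : Fin k => (((i * (k - ℓ) + (j : ℕ)) : ℕ) : ZMod m))
      Finset.univ)

/-- The `k`-graph on `Fin n` with edge set `E` contains a Hamilton `ℓ`-cycle:
there is a cyclic ordering of all `n` vertices such that all edges of the
corresponding spanning `ℓ`-cycle are edges of `E`. -/
def HamiltonLCycle (k ℓ : ℕ) {n : ℕ} (E : Finset (Finset (Fin n))) : Prop :=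
  2 * k - ℓ ≤ n ∧ (k - ℓ) ∣ n ∧
    ∃ σ : ZMod n ≃ Fin n, ∀ e ∈ cycleGraph k ℓ n, e.image (fun v => σ v) ∈ E

/-- The `k`-graph on `Fin n` with edge set `E` has minimum `d`-degree at least `x`:
every `d`-set of vertices is contained in at least `x` edges. -/
def MinDegGe {n : ℕ} (d : ℕ) (E : Finset (Finset (Fin n))) (x : ℝ) : Prop :=
  ∀ S : Finset (Fin n), S.card = d → x ≤ ((E.filter (fun e => S ⊆ e)).card : ℝ)

/-- `δ` is a valid constant for the minimum `d`-degree threshold for Hamilton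
`ℓ`-cycles in `k`-graphs. -/
def HamMinDegProp (k ℓ d : ℕ) (δ : ℝ) : Prop :=
  ∀ ε : ℝ, 0 < ε → ∃ n₀ : ℕ, ∀ n : ℕ, n₀ ≤ n → (k - ℓ) ∣ n →
    ∀ E : Finset (Finset (Fin n)), (∀ e ∈ E, e.card = k) →
      MinDegGe d E ((δ + ε) * ((n - d).choose (k - d) : ℝ)) →
      HamiltonLCycle k ℓ E

/-- The minimum `d`-degree threshold `δ_d^{ham}(k,ℓ)` for Hamilton `ℓ`-cycles in
`k`-graphs. -/
noncomputable def hamThreshold (k ℓ d : ℕ) : ℝ :=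
  sInf {δ : ℝ | 0 ≤ δ ∧ δ ≤ 1 ∧ HamMinDegProp k ℓ d δ}

/-- `λ(k,ℓ) = 1 / (⌈k/(k-ℓ)⌉ · (k-ℓ))`. -/
noncomputable def lam (k ℓ : ℕ) : ℝ :=
  1 / ((⌈(k : ℝ) / ((k - ℓ : ℕ) : ℝ)⌉₊ : ℝ) * ((k - ℓ : ℕ) : ℝ))

/-- The chromatic number of the hypergraph with edge set `E` on the finite vertex
type `V`: the least `t` admitting a colouring with `t` colours in which no edge
contains two vertices of the same colour. -/
noncomputable def hgChrom {V : Type} [Fintype V] (E : Finset (Finset V)) : ℕ :=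
  sInf {t : ℕ | ∃ c : V → Fin t, ∀ e ∈ E, Set.InjOn c (e : Set V)}

open Classical in
/-- The set `D(F)` of differences `||c⁻¹(colour 0)| - |c⁻¹(colour 1)||` over all proper
`χ(F)`-colourings `c` of the hypergraph `F` with edge set `E`. -/
noncomputable def hgColorDiffFinset {V : Type} [Fintype V] [DecidableEq V]
    (E : Finset (Finset V)) : Finset ℕ :=
  (Finset.univ.filter
      (fun c : V → Fin (hgChrom E) => ∀ e ∈ E, Set.InjOn c (e : Set V))).image
    (fun c =>
      (((Finset.univ.filter (fun v => (c v : ℕ) = 0)).card : ℤ) -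
        ((Finset.univ.filter (fun v => (c v : ℕ) = 1)).card : ℤ)).natAbs)

open Equiv Finset

/-- Let `b` and `b'` be the colours read along two consecutive edges of an `ℓ`-cycle with
`r = k - ℓ`.  The second edge repeats the last `k - r` colours of the first one. -/
def ColourStep (k r : ℕ) (b b' : Perm (ZMod k)) : Prop :=
  ∀ j : ℕ, j + r < k → b' (j : ZMod k) = b ((j + r : ℕ) : ZMod k)

/-- `g` arises from the identity by `T` colour steps. -/
def Reachable (k r T : ℕ) (g : Perm (ZMod k)) : Prop :=
  ∃ s : ℕ → Perm (ZMod k), s 0 = 1 ∧ s T = g ∧ ∀ i < T, ColourStep k r (s i) (s (i + 1))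

/-- Rotation of `ZMod k` by `a`. -/
def rot {k : ℕ} (a : ZMod k) : Perm (ZMod k) := Equiv.addRight a

@[simp] lemma rot_apply {k : ℕ} (a p : ZMod k) : rot a p = p + a := rfl

lemma rot_mul_rot {k : ℕ} (a b : ZMod k) : rot a * rot b = rot (a + b) := by
  ext p; simp [add_assoc, add_comm a b]

lemma rot_zero {k : ℕ} : rot (0 : ZMod k) = 1 := by
  ext p; simp

lemma rot_inv {k : ℕ} (a : ZMod k) : (rot a)⁻¹ = rot (-a) := by
  rw [inv_eq_iff_mul_eq_one, rot_mul_rot, add_neg_cancel, rot_zero]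

lemma rot_pow {k : ℕ} (a : ZMod k) (n : ℕ) : rot a ^ n = rot ((n : ZMod k) * a) := by
  induction n with
  | zero => simp [rot_zero]
  | succ n ih => rw [pow_succ, ih, rot_mul_rot]; congr 1; push_cast; ring

section Reachability

variable {k r : ℕ}

lemma Reachable.zero : Reachable k r 0 1 := ⟨fun _ => 1, rfl, rfl, by simp⟩

lemma Reachable.mul {S T : ℕ} {g h : Perm (ZMod k)} (hg : Reachable k r S g)
    (hh : Reachable k r T h) : Reachable k r (S + T) (g * h) := by
  obtain ⟨s, s0, sS, hs⟩ := hg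
  obtain ⟨t, t0, tT, ht⟩ := hh
  refine ⟨fun i => if i ≤ S then s i else g * t (i - S), by simp [s0], ?_, ?_⟩
  · rcases Nat.eq_zero_or_pos T with rfl | hT
    · simp [sS, ← tT, t0]
    · simp [tT, hT.ne']
  · intro i hi j hj
    rcases lt_trichotomy i S with h | rfl | h
    · simpa [h.le, Nat.succ_le_of_lt h] using hs i h j hj
    · have := ht 0 (by omega) j hj
      simp [this, t0, sS]
    · have := ht (i - S) (by omega) j hj
      rw [← Nat.sub_add_comm h.le] at this
      simp [h.not_ge, show ¬ i + 1 ≤ S by omega, this]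

lemma Reachable.pow {T : ℕ} {g : Perm (ZMod k)} (hg : Reachable k r T g) (n : ℕ) :
    Reachable k r (T * n) (g ^ n) := by
  induction n with
  | zero => exact .zero
  | succ n ih => rw [pow_succ, Nat.mul_succ]; exact ih.mul hg

lemma reachable_one_rot_mul (π : Perm (ZMod k)) (hπ : ∀ j : ℕ, j + r < k → π j = j) :
    Reachable k r 1 (rot (r : ZMod k) * π) := by
  refine ⟨fun i => if i = 0 then 1 else rot (r : ZMod k) * π, rfl, rfl, ?_⟩
  intro i hi j hj
  obtain rfl : i = 0 := by omega
  simp [hπ j hj]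

lemma reachable_rot (T : ℕ) : Reachable k r T (rot (T * r : ZMod k)) := by
  have := (reachable_one_rot_mul (k := k) (r := r) 1 (by simp)).pow T
  rwa [one_mul, mul_one, rot_pow] at this

lemma reachable_self_one : Reachable k r k 1 := by
  simpa [rot_zero] using reachable_rot (k := k) (r := r) k

variable [NeZero k]

omit [NeZero k] in
lemma natCast_zmod_inj {a b : ℕ} (ha : a < k) (hb : b < k) (h : (a : ZMod k) = b) : a = b := by
  have := congrArg ZMod.val h
  rwa [ZMod.val_cast_of_lt ha, ZMod.val_cast_of_lt hb] at this

lemma exists_natCast_zmod_eq (p : ZMod k) : ∃ j < k, (j : ZMod k) = p :=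
  ⟨p.val, p.val_lt, ZMod.natCast_zmod_val p⟩

/-- Within `k` steps one can permute any window of `r` cyclically consecutive positions that
starts at a multiple of `r`. -/
lemma reachable_of_window (hr : r ≤ k) (π : Perm (ZMod k)) (n : ℕ)
    (hπ : ∀ p : ZMod k, (∀ j < r, p ≠ n * r + (j : ZMod k)) → π p = p) :
    Reachable k r k π := by
  have hk : 0 < k := NeZero.pos k
  have hi : n % k < k := Nat.mod_lt _ hk
  have hn : (n : ZMod k) = ((n % k : ℕ) : ZMod k) := by simp
  rw [hn] at hπ
  generalize n % k = i at hi hπ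
  let a : ZMod k := (i + 1) * r
  have h₁ := reachable_one_rot_mul (r := r) (rot (-a) * π * rot a) (by
    intro j hj
    have : π (j + a) = j + a := by
      apply hπ
      intro j' hj' h
      have h' : ((j + r : ℕ) : ZMod k) = j' := by
        push_cast
        linear_combination h
      have := natCast_zmod_inj hj (by omega) h'
      omega
    simp [this])
  have h₂ := ((reachable_rot (k := k) (r := r) i).mul h₁).mul (reachable_rot (k - i - 1))
  have hT : i + 1 + (k - i - 1) = k := by omega
  have hc : ((k - i - 1 : ℕ) : ZMod k) = -(i + 1) := by
    have := congrArg (Nat.cast (R := ZMod k)) hT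
    push_cast at this
    rw [ZMod.natCast_self] at this
    linear_combination this
  rw [hT, hc] at h₂
  convert h₂ using 1
  ext p
  simp only [Perm.mul_apply, rot_apply, a]
  rw [show p + -((i : ZMod k) + 1) * r + (i + 1) * r = p by ring]
  ring

/-- `g` and its inverse can both be reached in `n` rounds of `k` steps. -/
def RoundReachable (k r n : ℕ) (g : Perm (ZMod k)) : Prop :=
  Reachable k r (k * n) g ∧ Reachable k r (k * n) g⁻¹

omit [NeZero k] in
lemma RoundReachable.inv {n : ℕ} {g : Perm (ZMod k)} (h : RoundReachable k r n g) :
    RoundReachable k r n g⁻¹ := ⟨h.2, by simpa using h.1⟩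

omit [NeZero k] in
lemma RoundReachable.mul {m n : ℕ} {g h : Perm (ZMod k)} (hg : RoundReachable k r m g)
    (hh : RoundReachable k r n h) : RoundReachable k r (m + n) (g * h) := by
  refine ⟨by rw [mul_add]; exact hg.1.mul hh.1, ?_⟩
  rw [mul_inv_rev, add_comm, mul_add]
  exact hh.2.mul hg.2

lemma roundReachable_of_interval (hr : r ≤ k) (a d : ℕ) (had : a % r.gcd k + d ≤ r)
    (π : Perm (ZMod k)) (hπ : ∀ p : ZMod k, (∀ x, a ≤ x → x < a + d → p ≠ x) → π p = p) :
    RoundReachable k r 1 π := by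
  have key : ∀ σ : Perm (ZMod k), (∀ p : ZMod k, (∀ x, a ≤ x → x < a + d → p ≠ x) → σ p = p) →
      Reachable k r k σ := by
    intro σ hσ
    let b : ZMod k := (r.gcdA k : ZMod k) * (a / r.gcd k : ℕ)
    have hb : b * r = ((r.gcd k * (a / r.gcd k) : ℕ) : ZMod k) := by
      have h := congrArg (Int.cast (R := ZMod k)) (Nat.gcd_eq_gcd_ab r k)
      push_cast at h ⊢
      rw [h, ZMod.natCast_self]
      ring
    refine reachable_of_window hr σ b.val fun p hp => hσ p fun x hx hx' hpx => ?_
    have hdm := Nat.div_add_mod a (r.gcd k)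
    refine hp (x - r.gcd k * (a / r.gcd k)) (by omega) ?_
    rw [ZMod.natCast_zmod_val, hb, ← Nat.cast_add, hpx]
    congr 1
    omega
  refine ⟨by simpa using key π hπ, ?_⟩
  rw [mul_one]
  refine key π⁻¹ fun p hp => ?_
  rw [Perm.inv_eq_iff_eq, hπ p hp]

lemma reachable_one_of_roundReachable_rot {n N : ℕ} (h : RoundReachable k r n (rot 1))
    (hN : k * n * (k / 2) ≤ N) : Reachable k r N 1 := by
  have hpow : ∀ j : ℕ, Reachable k r (k * n * (k / 2)) (rot (j : ZMod k)) := by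
    intro j
    have hpad : ∀ (g : Perm (ZMod k)) (i : ℕ), RoundReachable k r n g → i ≤ k / 2 →
        Reachable k r (k * n * (k / 2)) (g ^ i) := by
      intro g i hg hi
      have h1 := (hg.1.pow i)
      have h2 := (reachable_self_one (k := k) (r := r)).pow (n * (k / 2 - i))
      have h3 := h1.mul h2
      rw [one_pow, mul_one] at h3
      convert h3 using 1
      obtain ⟨d, hd⟩ := Nat.exists_eq_add_of_le hi
      rw [hd, Nat.add_sub_cancel_left]
      ring
    have hj : j % k < k := Nat.mod_lt _ (NeZero.pos k)
    have hjk : (j : ZMod k) = ((j % k : ℕ) : ZMod k) := by simp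
    rw [hjk]
    generalize j % k = i at hj
    rcases le_or_gt i (k / 2) with hi | hi
    · simpa [rot_pow] using hpad _ i h hi
    · have := hpad _ (k - i) h.inv (by omega)
      rw [rot_inv, rot_pow, Nat.cast_sub hj.le, ZMod.natCast_self] at this
      simpa using this
  obtain ⟨d, rfl⟩ := Nat.exists_eq_add_of_le hN
  obtain ⟨j, -, hj⟩ := exists_natCast_zmod_eq (-((d : ZMod k) * (r : ZMod k)))
  have := (hpow j).mul (reachable_rot (k := k) (r := r) d)
  rwa [hj, rot_mul_rot, neg_add_cancel, rot_zero] at this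

end Reachability

section RotationAsProduct

variable {k r : ℕ}

lemma List.formPerm_append_cons {α : Type*} [DecidableEq α] (l l' : List α) (a : α) :
    (l ++ a :: l').formPerm = (l ++ [a]).formPerm * (a :: l').formPerm := by
  induction l with
  | nil => simp
  | cons x l ih => cases l <;> simp_all [mul_assoc]

/-- The cyclic permutation of the `n` residues starting at `a`. -/
def intervalCycle (k a n : ℕ) : Perm (ZMod k) :=
  ((List.range' a n).map (Nat.cast : ℕ → ZMod k)).formPerm

lemma intervalCycle_apply_of_ne (a n : ℕ) (p : ZMod k)
    (hp : ∀ x, a ≤ x → x < a + n → p ≠ x) : intervalCycle k a n p = p := by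
  refine List.formPerm_apply_of_notMem fun h => ?_
  obtain ⟨x, hx, rfl⟩ := List.mem_map.1 h
  rw [List.mem_range'_1] at hx
  exact hp x hx.1 hx.2 rfl

lemma intervalCycle_add (a m n : ℕ) :
    intervalCycle k a (m + n + 1) = intervalCycle k a (m + 1) * intervalCycle k (a + m) (n + 1) := by
  have h := List.formPerm_append_cons ((List.range' a m).map (Nat.cast : ℕ → ZMod k))
    ((List.range' (a + m + 1) n).map Nat.cast) ((a + m : ℕ) : ZMod k)
  unfold intervalCycle
  convert h using 2
  · rw [add_assoc, ← List.range'_append_1, List.range'_succ]; simp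
  · rw [← List.range'_append_1]; simp
  · simp [List.range'_succ]

lemma intervalCycle_self [NeZero k] : intervalCycle k 0 k = rot 1 := by
  ext p
  obtain ⟨j, hj, rfl⟩ := exists_natCast_zmod_eq p
  have hnd : ((List.range' 0 k).map (Nat.cast : ℕ → ZMod k)).Nodup := by
    refine List.Nodup.map_on (fun x hx y hy h => ?_) List.nodup_range'
    simp only [List.mem_range'_1] at hx hy
    exact natCast_zmod_inj (by omega) (by omega) h
  have h := List.formPerm_apply_getElem _ hnd j (by simpa using hj)
  simp only [List.getElem_map, List.getElem_range', List.length_map, List.length_range'] at h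
  simpa [intervalCycle] using h

variable [NeZero k]

lemma roundReachable_intervalCycle (hr : r ≤ k) (hg : r.gcd k < r) (a n : ℕ) :
    RoundReachable k r n (intervalCycle k a (n + 1)) := by
  have hpos : 0 < r.gcd k := Nat.gcd_pos_of_pos_right _ (NeZero.pos k)
  induction n with
  | zero =>
    have h : intervalCycle k a (0 + 1) = 1 := by simp [intervalCycle]
    rw [h]
    exact ⟨.zero, by simpa using Reachable.zero⟩
  | succ n ih =>
    rw [intervalCycle_add a n 1]
    refine ih.mul (roundReachable_of_interval hr (a + n) 2 ?_ _ (intervalCycle_apply_of_ne _ _))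
    have := Nat.mod_lt (a + n) hpos
    omega

lemma roundReachable_two_rot (hr : r < k) (hg : r.gcd k < r) (h2 : k < 2 * r) :
    RoundReachable k r 2 (rot 1) := by
  have hpos : 0 < r.gcd k := Nat.gcd_pos_of_pos_right _ (NeZero.pos k)
  have hdr : r.gcd k ∣ r := Nat.gcd_dvd_left r k
  have hdk : r.gcd k ∣ k := Nat.gcd_dvd_right r k
  have hsplit : intervalCycle k 0 k
      = intervalCycle k 0 r * intervalCycle k (r - 1) (k - r + 1) := by
    have := intervalCycle_add (k := k) 0 (r - 1) (k - r)
    rwa [show r - 1 + (k - r) + 1 = k by omega, Nat.sub_add_cancel (by omega), zero_add] at this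
  rw [← intervalCycle_self, hsplit]
  refine (roundReachable_of_interval hr.le 0 r (by simp) _ fun p hp =>
    intervalCycle_apply_of_ne _ _ p hp).mul
    (roundReachable_of_interval hr.le (r - 1) (k - r + 1) ?_ _ (intervalCycle_apply_of_ne _ _))
  have hle : r.gcd k ≤ 2 * r - k :=
    Nat.le_of_dvd (by omega) (Nat.dvd_sub (hdr.mul_left 2) hdk)
  have := Nat.mod_lt (r - 1) hpos
  omega

lemma reachable_one (hr0 : 0 < r) (hr : r < k) (hnd : ¬ r ∣ k) {N : ℕ}
    (hN : k ^ 2 * (k - r) + 1 ≤ N + (k / r) ^ 2) : Reachable k r N 1 := by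
  have hg : r.gcd k < r := lt_of_le_of_ne (Nat.gcd_le_left k hr0) fun h =>
    hnd (h ▸ Nat.gcd_dvd_right r k)
  have hkk : 2 * (k / 2) ≤ k := Nat.mul_div_le k 2
  obtain ⟨l, rfl⟩ := Nat.exists_eq_add_of_le hr.le
  rw [Nat.add_sub_cancel_left] at hN
  rcases lt_or_ge (r + l) (2 * r) with h2 | h2
  · refine reachable_one_of_roundReachable_rot (roundReachable_two_rot hr hg h2) ?_
    have hq : (r + l) / r = 1 := Nat.div_eq_of_lt_le (by omega) (by omega)
    rw [hq] at hN
    have : 1 ≤ l := by omega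
    nlinarith [Nat.mul_le_mul_left ((r + l) ^ 2) this,
      Nat.mul_le_mul_left (r + l) hkk]
  · have h := roundReachable_intervalCycle hr.le hg 0 (r + l - 1)
    rw [Nat.sub_add_cancel (by omega), intervalCycle_self] at h
    refine reachable_one_of_roundReachable_rot h ?_
    have hr2 : 2 ≤ r := by
      by_contra h1
      obtain rfl : r = 1 := by omega
      exact hnd (one_dvd _)
    have hq : 2 * ((r + l) / r) ≤ r + l :=
      (Nat.mul_le_mul_right _ hr2).trans (Nat.mul_div_le (r + l) r)
    generalize (r + l) / r = q at *
    generalize (r + l) / 2 = t at *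
    have hkl : r + l ≤ 2 * l := by omega
    obtain ⟨c, hc⟩ : ∃ c, r + l = c + 1 := ⟨r + l - 1, by omega⟩
    rw [hc] at hN hkk hq hkl
    rw [hc, Nat.add_sub_cancel]
    have e1 : (c + 1) * c * (2 * t) ≤ (c + 1) * c * (c + 1) := Nat.mul_le_mul_left _ hkk
    have e2 : (c + 1) ^ 2 * (c + 1) ≤ (c + 1) ^ 2 * (2 * l) := Nat.mul_le_mul_left _ hkl
    have e3 : 2 * q * (2 * q) ≤ (c + 1) * (c + 1) := Nat.mul_le_mul hq hq
    nlinarith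

end RotationAsProduct

section Colouring

variable {k r N : ℕ}

/-- A closed sequence of `N` colour steps. -/
def ClosedSeq (k r N : ℕ) (s : ℕ → Perm (ZMod k)) : Prop :=
  s N = s 0 ∧ ∀ i < N, ColourStep k r (s i) (s (i + 1))

/-- The colouring of the cycle on `ZMod M` in which the `i`-th edge reads `s i`. -/
def seqColouring (k r M : ℕ) (s : ℕ → Perm (ZMod k)) (v : ZMod M) : ZMod k :=
  s (v.val / r) ((v.val % r : ℕ) : ZMod k)

lemma ClosedSeq.apply_add {s : ℕ → Perm (ZMod k)} (hs : ClosedSeq k r N s) {i t j : ℕ}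
    (hi : i + t ≤ N) (hj : j + t * r < k) :
    s (i + t) (j : ZMod k) = s i ((j + t * r : ℕ) : ZMod k) := by
  induction t generalizing j with
  | zero => simp
  | succ t ih =>
    rw [Nat.succ_mul] at hj
    rw [← add_assoc, hs.2 (i + t) (by omega) j (by omega), ih (by omega) (by omega)]
    congr 2
    ring

lemma ClosedSeq.apply_div_mod {s : ℕ → Perm (ZMod k)} (hs : ClosedSeq k r N s) {i j : ℕ}
    (hi : i + j / r ≤ N) (hj : j < k) :
    s (i + j / r) ((j % r : ℕ) : ZMod k) = s i (j : ZMod k) := by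
  have h := Nat.mod_add_div' j r
  rw [hs.apply_add hi (by omega), h]

lemma seqColouring_edge [NeZero (N * r)] {s : ℕ → Perm (ZMod k)} (hs : ClosedSeq k r N s)
    (hkN : k ≤ N * r) {i j : ℕ} (hi : i < N) (hj : j < k) :
    seqColouring k r (N * r) s ((i * r + j : ℕ) : ZMod (N * r)) = s i (j : ZMod k) := by
  have hr : 0 < r := Nat.pos_of_ne_zero (right_ne_zero_of_mul (NeZero.ne (N * r)))
  unfold seqColouring
  rcases lt_or_ge (i * r + j) (N * r) with h | h
  · rw [ZMod.val_cast_of_lt h, Nat.mul_add_mod', Nat.add_comm, Nat.add_mul_div_right _ _ hr,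
      Nat.add_comm]
    refine hs.apply_div_mod ?_ hj
    have : i + j / r < N := by
      rwa [Nat.add_comm i, ← Nat.add_mul_div_right _ _ hr, Nat.div_lt_iff_lt_mul hr, Nat.add_comm]
    exact this.le
  · obtain ⟨d, rfl⟩ := Nat.exists_eq_add_of_le hi.le
    rw [add_mul] at h
    obtain ⟨j', rfl⟩ := Nat.exists_eq_add_of_le (show d * r ≤ j by omega)
    have hmul : i * r + (d * r + j') = (i + d) * r + j' := by ring
    rw [hmul, Nat.cast_add, ZMod.natCast_self, zero_add, ZMod.val_cast_of_lt (by omega)]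
    have h0 := hs.apply_div_mod (i := 0) (j := j')
      (by rw [zero_add]; exact (Nat.div_lt_of_lt_mul (by rw [mul_comm]; omega)).le) (by omega)
    rw [zero_add] at h0
    rw [h0, ← hs.1, hs.apply_add le_rfl (by omega), Nat.add_comm]

lemma mem_cycleGraph_iff {l M : ℕ} {e : Finset (ZMod M)} :
    e ∈ cycleGraph k l M ↔ ∃ i < M / (k - l),
      e = univ.image (fun j : Fin k => ((i * (k - l) + (j : ℕ) : ℕ) : ZMod M)) := by
  simp [cycleGraph, eq_comm]

variable {l : ℕ} [NeZero (N * (k - l))]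

lemma exists_edge_eq {e : Finset (ZMod (N * (k - l)))}
    (he : e ∈ cycleGraph k l (N * (k - l))) : ∃ i < N, e = univ.image
      (fun j : Fin k => ((i * (k - l) + (j : ℕ) : ℕ) : ZMod (N * (k - l)))) := by
  have hr : 0 < k - l := Nat.pos_of_ne_zero (right_ne_zero_of_mul (NeZero.ne (N * (k - l))))
  obtain ⟨i, hi, rfl⟩ := mem_cycleGraph_iff.1 he
  exact ⟨i, by rwa [Nat.mul_div_cancel _ hr] at hi, rfl⟩

/-- Every edge of the cycle meets every colour exactly once. -/
lemma existsUnique_mem_edge [NeZero k] {s : ℕ → Perm (ZMod k)} (hs : ClosedSeq k (k - l) N s)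
    (hkN : k ≤ N * (k - l)) {e : Finset (ZMod (N * (k - l)))}
    (he : e ∈ cycleGraph k l (N * (k - l))) (x : ZMod k) :
    ∃! v, v ∈ e ∧ seqColouring k (k - l) (N * (k - l)) s v = x := by
  obtain ⟨i, hi, rfl⟩ := exists_edge_eq he
  obtain ⟨j, hj, hjx⟩ := exists_natCast_zmod_eq ((s i).symm x)
  refine ⟨((i * (k - l) + j : ℕ) : ZMod (N * (k - l))),
    ⟨mem_image.2 ⟨⟨j, hj⟩, mem_univ _, rfl⟩, ?_⟩, ?_⟩
  · rw [seqColouring_edge hs hkN hi hj, hjx, Equiv.apply_symm_apply]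
  · rintro v ⟨hv, hvx⟩
    obtain ⟨j', -, rfl⟩ := mem_image.1 hv
    rw [seqColouring_edge hs hkN hi j'.2, ← Equiv.eq_symm_apply, ← hjx] at hvx
    rw [natCast_zmod_inj j'.2 hj hvx]

lemma seqColouring_injOn [NeZero k] {s : ℕ → Perm (ZMod k)} (hs : ClosedSeq k (k - l) N s)
    (hkN : k ≤ N * (k - l)) {e : Finset (ZMod (N * (k - l)))}
    (he : e ∈ cycleGraph k l (N * (k - l))) :
    Set.InjOn (seqColouring k (k - l) (N * (k - l)) s) e := fun _ hv _ hw h =>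
  (existsUnique_mem_edge hs hkN he _).unique ⟨hv, h⟩ ⟨hw, rfl⟩

lemma zmodEquivFin_exists (k : ℕ) [NeZero k] : Nonempty (ZMod k ≃ Fin k) :=
  ⟨Fintype.equivFinOfCardEq (ZMod.card k)⟩

lemma hgChrom_cycleGraph [NeZero k] {s : ℕ → Perm (ZMod k)} (hs : ClosedSeq k (k - l) N s)
    (hkN : k ≤ N * (k - l)) : hgChrom (cycleGraph k l (N * (k - l))) = k := by
  have hr : 0 < k - l := Nat.pos_of_ne_zero (right_ne_zero_of_mul (NeZero.ne (N * (k - l))))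
  have hN : 0 < N := Nat.pos_of_ne_zero (left_ne_zero_of_mul (NeZero.ne (N * (k - l))))
  obtain ⟨φ⟩ := zmodEquivFin_exists k
  have hmem : k ∈ {t : ℕ | ∃ c : ZMod (N * (k - l)) → Fin t,
      ∀ e ∈ cycleGraph k l (N * (k - l)), Set.InjOn c (e : Set (ZMod (N * (k - l))))} :=
    ⟨φ ∘ seqColouring k (k - l) (N * (k - l)) s, fun e he =>
      φ.injective.comp_injOn (seqColouring_injOn hs hkN he)⟩
  refine le_antisymm (Nat.sInf_le hmem) (le_csInf ⟨k, hmem⟩ ?_)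
  rintro t ⟨c, hc⟩
  have he : univ.image (fun j : Fin k => ((0 * (k - l) + (j : ℕ) : ℕ) : ZMod (N * (k - l))))
      ∈ cycleGraph k l (N * (k - l)) :=
    mem_cycleGraph_iff.2 ⟨0, by rwa [Nat.mul_div_cancel _ hr], rfl⟩
  have h := card_le_card_of_injOn c (fun _ _ => mem_univ _) (hc _ he)
  rw [card_image_of_injective, card_univ, card_univ, Fintype.card_fin, Fintype.card_fin] at h
  · exact h
  · intro a b hab
    simp only [zero_mul, zero_add] at hab
    exact Fin.ext (natCast_zmod_inj (a.2.trans_le hkN) (b.2.trans_le hkN) hab)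

end Colouring

section Counting

variable {k r N : ℕ}

/-- The number of times the colour `x` occurs among the first `r` positions along `s`. -/
def colourCount (r N : ℕ) (s : ℕ → Perm (ZMod k)) (x : ZMod k) : ℕ :=
  ∑ i ∈ range N, #{j ∈ range r | s i ((j : ℕ) : ZMod k) = x}

lemma card_range_mul_filter (p : ℕ → ℕ → Prop) [∀ a b, Decidable (p a b)] (N : ℕ) :
    #{n ∈ range (N * r) | p (n / r) (n % r)} = ∑ i ∈ range N, #{j ∈ range r | p i j} := by
  rcases Nat.eq_zero_or_pos r with rfl | hr
  · simp
  simp only [card_filter]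
  induction N with
  | zero => simp
  | succ N ih =>
    rw [Nat.succ_mul, sum_range_add, sum_range_succ, ih]
    congr 1
    refine sum_congr rfl fun j hj => ?_
    rw [mem_range] at hj
    rw [Nat.mul_add_mod', Nat.mod_eq_of_lt hj, Nat.add_comm, Nat.add_mul_div_right _ _ hr,
      Nat.div_eq_of_lt hj, zero_add]

lemma card_seqColouring_eq [NeZero (N * r)] (s : ℕ → Perm (ZMod k)) (x : ZMod k) :
    #{v : ZMod (N * r) | seqColouring k r (N * r) s v = x} = colourCount r N s x := by
  rw [colourCount, ← card_range_mul_filter (fun i j => s i ((j : ℕ) : ZMod k) = x)]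
  refine card_nbij' ZMod.val (fun n => (n : ZMod (N * r))) ?_ ?_ ?_ ?_
  · intro v hv
    have hv := (mem_filter.1 (mem_coe.1 hv)).2
    exact mem_coe.2 (mem_filter.2 ⟨mem_range.2 v.val_lt, hv⟩)
  · intro n hn
    obtain ⟨hn, hx⟩ := mem_filter.1 (mem_coe.1 hn)
    refine mem_coe.2 (mem_filter.2 ⟨mem_univ _, ?_⟩)
    rwa [seqColouring, ZMod.val_cast_of_lt (mem_range.1 hn)]
  · intro v _
    simp
  · intro n hn
    exact ZMod.val_cast_of_lt (mem_range.1 (mem_filter.1 (mem_coe.1 hn)).1)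

lemma natAbs_mem_hgColorDiffFinset {V : Type} [Fintype V] [DecidableEq V]
    (E : Finset (Finset V)) {t : ℕ} (ht : hgChrom E = t) (c : V → Fin t)
    (hc : ∀ e ∈ E, Set.InjOn c (e : Set V)) :
    ((#{v | (c v : ℕ) = 0} : ℤ) - (#{v | (c v : ℕ) = 1} : ℤ)).natAbs ∈ hgColorDiffFinset E := by
  subst ht
  exact mem_image.2 ⟨c, by simpa using hc, by convert rfl⟩

lemma exists_equiv_fin_apply_eq [NeZero k] {x z : ZMod k} (hxz : x ≠ z) {a b : Fin k}
    (hab : a ≠ b) : ∃ φ : ZMod k ≃ Fin k, φ x = a ∧ φ z = b := by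
  obtain ⟨φ⟩ := zmodEquivFin_exists k
  let ψ := φ.trans (swap (φ x) a)
  have hx : ψ x = a := by simp [ψ]
  have hz : ψ z ≠ a := fun h => hxz (ψ.injective (hx.trans h.symm))
  exact ⟨ψ.trans (swap (ψ z) b), by simp [hx, swap_apply_of_ne_of_ne hz.symm hab], by simp⟩

lemma colourCount_sub_mem {l : ℕ} [NeZero (N * (k - l))] [NeZero k] (hk : 1 < k)
    {s : ℕ → Perm (ZMod k)} (hs : ClosedSeq k (k - l) N s)
    (hkN : k ≤ N * (k - l)) {x z : ZMod k} (hxz : x ≠ z) :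
    ((colourCount (k - l) N s x : ℤ) - colourCount (k - l) N s z).natAbs ∈
      hgColorDiffFinset (cycleGraph k l (N * (k - l))) := by
  obtain ⟨φ, hx, hz⟩ := exists_equiv_fin_apply_eq hxz
    (a := ⟨0, by omega⟩) (b := ⟨1, hk⟩) (by simp)
  have h := natAbs_mem_hgColorDiffFinset _ (hgChrom_cycleGraph hs hkN)
    (φ ∘ seqColouring k (k - l) (N * (k - l)) s)
    (fun e he => φ.injective.comp_injOn (seqColouring_injOn hs hkN he))
  rw [← card_seqColouring_eq, ← card_seqColouring_eq]
  convert h using 7 with v v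
  · rw [← φ.apply_eq_iff_eq, hx, Fin.ext_iff]; rfl
  · rw [← φ.apply_eq_iff_eq, hz, Fin.ext_iff]; rfl

end Counting

section ColumnShift

variable {k r : ℕ} [NeZero k]

/-- The colour step in which every vertex passes its colour on to the next vertex with the same
position within its block of `r` vertices. -/
noncomputable def columnShift (k r : ℕ) [NeZero k] (hr : 0 < r) : Perm (ZMod k) :=
  Equiv.ofBijective
    (fun p => if p.val + r < k then ((p.val + r : ℕ) : ZMod k) else ((p.val % r : ℕ) : ZMod k)) <| by
    refine Finite.injective_iff_bijective.1 fun p p' h => ?_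
    obtain ⟨a, ha, rfl⟩ := exists_natCast_zmod_eq p
    obtain ⟨b, hb, rfl⟩ := exists_natCast_zmod_eq p'
    simp only [ZMod.val_cast_of_lt ha, ZMod.val_cast_of_lt hb] at h
    have ha' := Nat.mod_lt a hr
    have hb' := Nat.mod_lt b hr
    have hal := Nat.mod_le a r
    have hbl := Nat.mod_le b r
    congr 1
    split_ifs at h with h₁ h₂ h₂
    · have := natCast_zmod_inj h₁ h₂ h
      omega
    · have := natCast_zmod_inj h₁ (by omega) h
      omega
    · have := natCast_zmod_inj (by omega) h₂ h
      omega
    · have h := natCast_zmod_inj (by omega) (by omega) h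
      refine Nat.ModEq.eq_of_abs_lt (m := r) h ?_
      rw [abs_lt]
      omega

lemma columnShift_apply (hr : 0 < r) {j : ℕ} (hj : j < k) :
    columnShift k r hr (j : ZMod k) =
      if j + r < k then ((j + r : ℕ) : ZMod k) else ((j % r : ℕ) : ZMod k) := by
  simp [columnShift, ZMod.val_cast_of_lt hj]

lemma colourStep_columnShift_pow (hr : 0 < r) (i : ℕ) :
    ColourStep k r (columnShift k r hr ^ i) (columnShift k r hr ^ (i + 1)) := by
  intro j hj
  rw [pow_succ, Perm.mul_apply, columnShift_apply hr (by omega), if_pos hj]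

/-- Positions congruent to `e` modulo `r` are permuted cyclically by the column shift. -/
lemma columnShift_pow_apply (hr : 0 < r) {e a : ℕ} (he : e < r) (hea : e + r * a < k) (i : ℕ) :
    (columnShift k r hr ^ i) ((e + r * a : ℕ) : ZMod k) =
      ((e + r * ((a + i) % ((k - 1 - e) / r + 1)) : ℕ) : ZMod k) := by
  have key : ∀ b, e + r * b < k ↔ b < (k - 1 - e) / r + 1 := by
    intro b
    rw [Nat.lt_succ_iff, Nat.le_div_iff_mul_le hr, mul_comm b]
    omega
  generalize (k - 1 - e) / r + 1 = Q at *
  have hQ : 0 < Q := by have := (key a).1 hea; omega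
  induction i with
  | zero => simp [Nat.mod_eq_of_lt ((key a).1 hea)]
  | succ i ih =>
    have hlt := Nat.mod_lt (a + i) hQ
    rw [pow_succ', Perm.mul_apply, ih, columnShift_apply hr ((key _).2 hlt), ← add_assoc,
      ← Nat.mod_add_mod (a + i)]
    generalize (a + i) % Q = b at *
    split_ifs with h
    · have hb : e + r * (b + 1) < k := by rw [mul_add]; omega
      rw [Nat.mod_eq_of_lt ((key _).1 hb)]
      congr 1
      ring
    · have hb : b + 1 = Q := by
        have := (key (b + 1)).not.1 (by rw [mul_add]; omega)
        omega
      rw [hb, Nat.mod_self, Nat.add_mul_mod_self_left, Nat.mod_eq_of_lt he, mul_zero, add_zero]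

lemma columnShift_pow_eq_one (hr : 0 < r) (hrk : r ≤ k) :
    columnShift k r hr ^ (k / r * (k / r + 1)) = 1 := by
  ext p
  obtain ⟨j, hj, rfl⟩ := exists_natCast_zmod_eq p
  have hjr := Nat.mod_lt j hr
  have hjm := Nat.mod_add_div j r
  have h := columnShift_pow_apply hr hjr (hjm.symm ▸ hj) (k / r * (k / r + 1))
  have hQ : (k - 1 - j % r) / r + 1 ∣ k / r * (k / r + 1) := by
    have h₁ : (k - 1 - j % r) / r ≤ k / r := Nat.div_le_div_right (by omega)
    have h₂ : k / r ≤ (k - 1 - j % r) / r + 1 := by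
      rw [← Nat.add_div_right _ hr]
      exact Nat.div_le_div_right (by omega)
    rcases h₁.eq_or_lt with h | h
    · rw [h]; exact Dvd.intro_left _ rfl
    · rw [show (k - 1 - j % r) / r + 1 = k / r by omega]; exact Dvd.intro _ rfl
  have hlt : j / r < (k - 1 - j % r) / r + 1 := by
    rw [Nat.lt_succ_iff, Nat.le_div_iff_mul_le hr, mul_comm]
    omega
  obtain ⟨c, hc⟩ := hQ
  rw [hjm] at h
  rw [h, hc, Nat.add_mul_mod_self_left, Nat.mod_eq_of_lt hlt, hjm, Perm.one_apply]

lemma card_columnShift_pow_eq (hr : 0 < r) (hrk : r ≤ k) {e : ℕ} (he : e < r) (i : ℕ) :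
    #{j ∈ range r | (columnShift k r hr ^ i) ((j : ℕ) : ZMod k) = (e : ZMod k)} =
      if (k - 1 - e) / r + 1 ∣ i then 1 else 0 := by
  have key : ∀ j < r, (columnShift k r hr ^ i) ((j : ℕ) : ZMod k) = (e : ZMod k) ↔
      j = e ∧ (k - 1 - e) / r + 1 ∣ i := by
    intro j hj
    have h := columnShift_pow_apply (k := k) (a := 0) hr hj (by omega) i
    simp only [mul_zero, add_zero, zero_add] at h
    have hlt : j + r * (i % ((k - 1 - j) / r + 1)) < k := by
      have h₁ : i % ((k - 1 - j) / r + 1) ≤ (k - 1 - j) / r :=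
        Nat.le_of_lt_succ (Nat.mod_lt i (Nat.succ_pos _))
      have h₂ := (Nat.mul_le_mul_left r h₁).trans (Nat.mul_div_le _ _)
      omega
    rw [h, Nat.dvd_iff_mod_eq_zero]
    constructor
    · intro h
      have h := natCast_zmod_inj hlt (by omega) h
      have hm : i % ((k - 1 - j) / r + 1) = 0 := by
        by_contra hne
        have := Nat.mul_le_mul_left r (Nat.pos_of_ne_zero hne)
        omega
      rw [hm] at h
      obtain rfl : j = e := by simpa using h
      exact ⟨rfl, hm⟩
    · rintro ⟨rfl, hm⟩
      simp [hm]
  split_ifs with hd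
  · rw [card_eq_one]
    refine ⟨e, ?_⟩
    ext j
    simp only [mem_filter, mem_range, mem_singleton]
    exact ⟨fun h => ((key j h.1).1 h.2).1, by rintro rfl; exact ⟨he, (key j he).2 ⟨rfl, hd⟩⟩⟩
  · rw [card_eq_zero, filter_eq_empty_iff]
    exact fun j hj h => hd ((key j (mem_range.1 hj)).1 h).2

end ColumnShift

section Swapping

variable {k r : ℕ} [NeZero k]

lemma sum_range_succ_dvd (T d : ℕ) :
    ∑ i ∈ range T, (if d ∣ i + 1 then 1 else 0) = T / d := by
  rw [← card_filter, Nat.card_multiples]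

/-- There are two closed sequences of colour steps in which the counts of a colour `x` differ
by one while the counts of another colour `z` agree. -/
lemma exists_closedSeq_pair (hr : 0 < r) (hrk : r < k) (hnd : ¬ r ∣ k) {N : ℕ}
    (hN : N = k ^ 2 * (k - r) + (k / r + 1)) :
    ∃ (s s' : ℕ → Perm (ZMod k)) (x z : ZMod k), x ≠ z ∧ ClosedSeq k r N s ∧ ClosedSeq k r N s' ∧
      colourCount r N s' x = colourCount r N s x + 1 ∧
      colourCount r N s' z = colourCount r N s z := by
  have hr2 : 2 ≤ r := by
    by_contra h
    obtain rfl : r = 1 := by omega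
    exact hnd (one_dvd _)
  have hdm := Nat.div_add_mod k r
  have hmod := Nat.mod_lt k hr
  have hmod0 : k % r ≠ 0 := fun h => hnd (Nat.dvd_of_mod_eq_zero h)
  set q := k / r with hq
  have hq0 : 0 < q := Nat.div_pos hrk.le hr
  have hqk : q ≤ k := Nat.div_le_self k r
  have hkr : 1 ≤ k - r := by omega
  set T := q * (q + 1) with hT
  have hT0 : 0 < T := by positivity
  have hTN : T < N := by
    have := Nat.mul_le_mul_left (k ^ 2) hkr
    nlinarith
  obtain ⟨t, t0, tN, ht⟩ : Reachable k r (N - T) 1 := by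
    refine reachable_one hr hrk hnd ?_
    rw [← hq]
    have : T = q ^ 2 + q := by rw [hT]; ring
    omega
  set u := columnShift k r hr with hu
  have huT : u ^ T = 1 := columnShift_pow_eq_one hr hrk.le
  let x : ZMod k := ((0 : ℕ) : ZMod k)
  let y : ZMod k := ((r - 1 : ℕ) : ZMod k)
  let z : ZMod k := ((k - 1 : ℕ) : ZMod k)
  have hne : ∀ {a b : ℕ}, a < k → b < k → a ≠ b → (a : ZMod k) ≠ b :=
    fun ha hb hab h => hab (natCast_zmod_inj ha hb h)
  have hxz : x ≠ z := hne (by omega) (by omega) (by omega)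
  have hyz : y ≠ z := hne (by omega) (by omega) (by omega)
  have hfix : ∀ j : ℕ, j + r < k → swap x y ((j + r : ℕ) : ZMod k) = ((j + r : ℕ) : ZMod k) :=
    fun j hj => swap_apply_of_ne_of_ne (hne hj (by omega) (by omega))
      (hne hj (by omega) (by omega))
  let s : ℕ → Perm (ZMod k) := fun i => if i ≤ T then u ^ i else t (i - T)
  let s' : ℕ → Perm (ZMod k) := fun i =>
    if i = 0 then 1 else if i ≤ T then swap x y * u ^ i else t (i - T)
  have hstep : ∀ i < N, ColourStep k r (s i) (s (i + 1)) := by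
    intro i hi j hj
    rcases lt_trichotomy i T with h | rfl | h
    · simpa [s, h.le, Nat.succ_le_of_lt h] using colourStep_columnShift_pow hr i j hj
    · have := ht 0 (by omega) j hj
      simpa [s, huT, t0] using this
    · have := ht (i - T) (by omega) j hj
      rw [← Nat.sub_add_comm h.le] at this
      simpa [s, h.not_ge, show ¬ i + 1 ≤ T by omega] using this
  have hstep' : ∀ i < N, ColourStep k r (s' i) (s' (i + 1)) := by
    intro i hi j hj
    have hs := hstep i hi j hj
    rcases Nat.eq_zero_or_pos i with rfl | h0
    · have hs : u (j : ZMod k) = ((j + r : ℕ) : ZMod k) := by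
        rw [hu, columnShift_apply hr (by omega), if_pos hj]
      simp only [s', zero_add, one_ne_zero, if_false, if_true, Nat.succ_le_of_lt hT0, pow_one,
        Perm.mul_apply, hs, hfix j hj, Perm.one_apply]
    rcases lt_trichotomy i T with h | rfl | h
    · simp only [s, h.le, Nat.succ_le_of_lt h, if_true] at hs
      simp only [s', h0.ne', h.le, Nat.succ_le_of_lt h, Nat.succ_ne_zero, if_true, if_false,
        Perm.mul_apply, hs]
    · have := ht 0 (by omega) j hj
      rw [t0, Perm.one_apply, zero_add] at this
      simp [s', huT, hT0.ne', -Nat.cast_add, hfix j hj, this]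
    · simpa [s, s', h0.ne', h.not_ge, show ¬ i + 1 ≤ T by omega] using hs
  obtain ⟨R, hR⟩ : ∃ R, N = T + 1 + R := Nat.exists_eq_add_of_le hTN
  have hcount : ∀ σ : ℕ → Perm (ZMod k), ∀ c, colourCount r N σ c =
      #{j ∈ range r | σ 0 ((j : ℕ) : ZMod k) = c} +
      ∑ i ∈ range T, #{j ∈ range r | σ (i + 1) ((j : ℕ) : ZMod k) = c} +
      ∑ i ∈ range R, #{j ∈ range r | σ (T + 1 + i) ((j : ℕ) : ZMod k) = c} := by
    intro σ c
    rw [colourCount, hR, sum_range_add, sum_range_succ', add_comm (∑ i ∈ range T, _)]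
  have hhead : s' 0 = s 0 := by simp [s, s']
  have htail : ∀ i, s' (T + 1 + i) = s (T + 1 + i) := by
    intro i
    simp [s, s', show ¬ T + 1 + i ≤ T by omega]
  have hmid : ∀ i ∈ range T, s (i + 1) = u ^ (i + 1) := by
    intro i hi
    simp [s, Nat.succ_le_of_lt (mem_range.1 hi)]
  have hmid' : ∀ i ∈ range T, s' (i + 1) = swap x y * u ^ (i + 1) := by
    intro i hi
    simp [s', Nat.succ_le_of_lt (mem_range.1 hi)]
  have hsN : s N = 1 := by simp [s, hTN.not_ge, tN]
  have hsN' : s' N = 1 := by simp [s', hTN.not_ge, (hT0.trans hTN).ne', tN]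
  refine ⟨s, s', x, z, hxz, ⟨hsN.trans (by simp [s]), hstep⟩, ⟨hsN'.trans (by simp [s']), hstep'⟩,
    ?_, ?_⟩
  · have h₁ : ∑ i ∈ range T, #{j ∈ range r | s (i + 1) ((j : ℕ) : ZMod k) = x} = q := by
      have hQ : (k - 1 - 0) / r + 1 = q + 1 := by
        congr 1
        exact Nat.div_eq_of_lt_le (by rw [mul_comm]; omega) (by rw [Nat.succ_mul, mul_comm]; omega)
      rw [sum_congr rfl fun i hi => by
        rw [hmid i hi, card_columnShift_pow_eq hr hrk.le hr, hQ], sum_range_succ_dvd, hT,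
        Nat.mul_div_cancel _ (Nat.succ_pos q)]
    have h₂ : ∑ i ∈ range T, #{j ∈ range r | s' (i + 1) ((j : ℕ) : ZMod k) = x} = q + 1 := by
      have hQ : (k - 1 - (r - 1)) / r + 1 = q := by
        rw [← Nat.add_div_right _ hr]
        congr 1
        omega
      rw [sum_congr rfl fun i hi => by
        simp only [hmid' i hi, Perm.mul_apply, swap_apply_eq_iff, swap_apply_left]
        rw [card_columnShift_pow_eq hr hrk.le (Nat.sub_lt hr one_pos), hQ], sum_range_succ_dvd, hT,
        Nat.mul_div_cancel_left _ hq0]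
    rw [hcount s', hcount s, h₁, h₂, hhead]
    simp only [htail]
    ring
  · rw [hcount s', hcount s, hhead]
    simp only [htail]
    congr 2
    refine sum_congr rfl fun i hi => ?_
    simp only [hmid i hi, hmid' i hi, Perm.mul_apply, swap_apply_eq_iff,
      swap_apply_of_ne_of_ne hxz.symm hyz.symm]

end Swapping

lemma natCeil_natCast_div_eq {k r : ℕ} (hr : 0 < r) (hnd : ¬ r ∣ k) :
    ⌈(k : ℝ) / (r : ℝ)⌉₊ = k / r + 1 := by
  have hr' : (0 : ℝ) < r := by exact_mod_cast hr
  have hdm := Nat.div_add_mod k r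
  have hmod := Nat.mod_lt k hr
  have hmod0 : k % r ≠ 0 := fun h => hnd (Nat.dvd_of_mod_eq_zero h)
  rw [Nat.ceil_eq_iff (Nat.succ_ne_zero _), Nat.succ_sub_one, lt_div_iff₀ hr', div_le_iff₀ hr']
  constructor
  · norm_cast
    rw [mul_comm]
    omega
  · norm_cast
    rw [Nat.succ_mul, mul_comm]
    omega

/-- **Lemma.** Let `1 ≤ ℓ ≤ k - 1` with `k - ℓ ∤ k` and `m ≥ ⌈k/(k-ℓ)⌉`.  Then the
`k`-uniform `ℓ`-cycle with `k²ℓ + m` edges (hence `M = (k²ℓ + m)(k-ℓ)` vertices) is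
`k`-partite.  Moreover, if `m = ⌈k/(k-ℓ)⌉`, then `gcd` of the nonzero elements of its
colour-difference set equals `1` (i.e. `gcd(C) = 1`). -/
theorem cycle_kpartite_and_gcd_one (k ℓ m M : ℕ) (hℓ1 : 1 ≤ ℓ) (hℓ2 : ℓ ≤ k - 1)
    (hnd : ¬ (k - ℓ) ∣ k) (hm : ⌈(k : ℝ) / ((k - ℓ : ℕ) : ℝ)⌉₊ ≤ m)
    (hM : M = (k ^ 2 * ℓ + m) * (k - ℓ)) [NeZero M] :
    (∃ P : Fin k → Finset (ZMod M),
      (∀ i j : Fin k, i ≠ j → Disjoint (P i) (P j)) ∧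
      (∀ v : ZMod M, ∃ i : Fin k, v ∈ P i) ∧
      (∀ e ∈ cycleGraph k ℓ M, ∀ i : Fin k, (e ∩ P i).card = 1)) ∧
    (m = ⌈(k : ℝ) / ((k - ℓ : ℕ) : ℝ)⌉₊ →
      ((hgColorDiffFinset (cycleGraph k ℓ M)).erase 0).gcd id = 1) := by
  have hr : 0 < k - ℓ := by omega
  have hrk : k - ℓ < k := by omega
  have hℓ : k - (k - ℓ) = ℓ := by omega
  have : NeZero k := ⟨by omega⟩
  rw [natCeil_natCast_div_eq hr hnd]
  have hq0 : 0 < k / (k - ℓ) := Nat.div_pos hrk.le hr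
  have hkN : k ≤ (k ^ 2 * ℓ + m) * (k - ℓ) := by
    have h₁ : k ≤ k ^ 2 * ℓ + m := by nlinarith [Nat.mul_le_mul_left (k ^ 2) hℓ1]
    exact h₁.trans (Nat.le_mul_of_pos_right _ hr)
  subst hM
  constructor
  · obtain ⟨s, s0, sN, hs⟩ : Reachable k (k - ℓ) (k ^ 2 * ℓ + m) 1 := by
      refine reachable_one hr hrk hnd ?_
      rw [hℓ]
      have := Nat.pow_pos (n := 2) hq0
      omega
    obtain ⟨φ⟩ := zmodEquivFin_exists k
    refine ⟨fun i => {v | φ (seqColouring k (k - ℓ) _ s v) = i}, ?_, ?_, ?_⟩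
    · intro i j hij
      rw [Finset.disjoint_left]
      intro v hv hv'
      exact hij ((Finset.mem_filter.1 hv).2.symm.trans (Finset.mem_filter.1 hv').2)
    · intro v
      exact ⟨_, Finset.mem_filter.2 ⟨Finset.mem_univ _, rfl⟩⟩
    · intro e he i
      obtain ⟨v, ⟨hv, hvx⟩, huniq⟩ :=
        existsUnique_mem_edge ⟨sN.trans s0.symm, hs⟩ hkN he (φ.symm i)
      rw [Finset.card_eq_one]
      refine ⟨v, ?_⟩
      ext w
      simp only [Finset.mem_inter, Finset.mem_filter, Finset.mem_univ, true_and,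
        Finset.mem_singleton, ← Equiv.eq_symm_apply]
      exact ⟨huniq w, by rintro rfl; exact ⟨hv, hvx⟩⟩
  · intro hm
    obtain ⟨s, s', x, z, hxz, hs, hs', hx, hz⟩ :=
      exists_closedSeq_pair hr hrk hnd (N := k ^ 2 * ℓ + m) (by rw [hℓ, hm])
    have h := colourCount_sub_mem (by omega) hs hkN hxz
    have h' := colourCount_sub_mem (by omega) hs' hkN hxz
    rw [hx, hz] at h'
    have key : ∀ a ∈ hgColorDiffFinset (cycleGraph k ℓ ((k ^ 2 * ℓ + m) * (k - ℓ))),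
        ((hgColorDiffFinset (cycleGraph k ℓ ((k ^ 2 * ℓ + m) * (k - ℓ)))).erase 0).gcd id ∣ a := by
      intro a ha
      rcases eq_or_ne a 0 with rfl | h0
      · exact dvd_zero _
      · exact Finset.gcd_dvd (f := id) (Finset.mem_erase.2 ⟨h0, ha⟩)
    have h₁ := Int.natCast_dvd.2 (key _ h)
    have h₂ := Int.natCast_dvd.2 (key _ h')
    have h₃ := dvd_sub h₂ h₁
    push_cast at h₃
    rw [add_sub_right_comm, add_sub_cancel_left] at h₃
    exact Nat.dvd_one.1 (by exact_mod_cast h₃)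
end

section
/- Let 1 ≤ ℓ ≤ k−1 with k−ℓ not dividing k, and let R be an ℓ-connected k-graph. Then there exists a k-uniform ℓ-cycle C with at most k⁴ edges which is k-partite and such that the C-lattice L_C(R) is complete. -/
/-- A hypergraph on a finite set of natural numbers. -/
structure HG where
  verts : Finset ℕ
  edges : Finset (Finset ℕ)

/-- `H` is a `k`-uniform hypergraph (a `k`-graph). -/
def HG.IsUniform (k : ℕ) (H : HG) : Prop := ∀ e ∈ H.edges, e ⊆ H.verts ∧ e.card = k

/-- Delete a vertex from a hypergraph (removing all edges through it). -/
def HG.delete (H : HG) (x : ℕ) : HG :=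
  ⟨H.verts.erase x, H.edges.filter (fun e => x ∉ e)⟩

/-- Union of two hypergraphs. -/
def HG.union (A B : HG) : HG := ⟨A.verts ∪ B.verts, A.edges ∪ B.edges⟩

/-- `H` is `ℓ`-connected: it has no isolated vertices and any two of its edges are
joined by a walk of edges of `H` in which consecutive edges share at least `ℓ`
vertices (i.e. its edges induce a connected subgraph of the `ℓ`-line graph). -/
def LConn (ℓ : ℕ) (H : HG) : Prop :=
  (∀ v ∈ H.verts, ∃ e ∈ H.edges, v ∈ e) ∧
  ∀ e ∈ H.edges, ∀ f ∈ H.edges,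
    Relation.ReflTransGen (fun a b => a ∈ H.edges ∧ b ∈ H.edges ∧ ℓ ≤ (a ∩ b).card) e f

/-- `FE` is the edge set of an `ℓ`-component of the hypergraph with edge set `GE`:
a nonempty set of edges which is connected in the `ℓ`-line graph and closed under
`ℓ`-adjacency (equivalently, edge-maximal `ℓ`-connected). -/
def IsLComponentEdges (ℓ : ℕ) (GE FE : Finset (Finset ℕ)) : Prop :=
  FE ⊆ GE ∧ FE.Nonempty ∧
  (∀ e ∈ FE, ∀ f ∈ FE,
    Relation.ReflTransGen (fun a b => a ∈ FE ∧ b ∈ FE ∧ ℓ ≤ (a ∩ b).card) e f) ∧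
  (∀ e ∈ FE, ∀ f ∈ GE, ℓ ≤ (e ∩ f).card → f ∈ FE)

/-- The hypergraph `H` has minimum `d`-degree at least `x`. -/
def HG.MinDegGe (H : HG) (d : ℕ) (x : ℝ) : Prop :=
  ∀ S : Finset ℕ, S ⊆ H.verts → S.card = d →
    x ≤ ((H.edges.filter (fun e => S ⊆ e)).card : ℝ)

/-- A colouring of `ℕ` by `Fin k` which is periodic with period `M` and is injective on every
interval of `k` consecutive integers starting at a multiple of `d`. -/
def IsRainbow (k d M : ℕ) (c : ℕ → Fin k) : Prop :=
  (∀ n, c (n % M) = c n) ∧ ∀ s, Function.Injective fun j : Fin k => c (s * d + j)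

/-- In blocks of length `d`, the vertex at offset `j` of block `i` is coloured by the pair of `j`
and the residue of `i` modulo `q + 1` if `j < r`, and modulo `q` otherwise. -/
def blockColor (q r d n : ℕ) : ℕ :=
  (n / d % (if n % d < r then q + 1 else q)) * d + n % d

/-- The colouring `blockColor` with two colours exchanged on every other interval of
`q * (q + 1)` blocks. -/
def blockColorSwap (q r d n : ℕ) : ℕ :=
  if n / d / (q * (q + 1)) % 2 = 0 then
    Equiv.swap (q * d) ((q - 1) * d + r) (blockColor q r d n)
  else blockColor q r d n

section Colouring

variable {q r d : ℕ}

theorem blockColor_mod (n : ℕ) : blockColor q r d n % d = n % d := by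
  simp [blockColor]

theorem blockColor_div (hd : r < d) (n : ℕ) :
    blockColor q r d n / d = n / d % (if n % d < r then q + 1 else q) := by
  have hd0 : 0 < d := by omega
  rw [blockColor, mul_comm, Nat.mul_add_div hd0, Nat.div_eq_of_lt (Nat.mod_lt _ hd0), add_zero]

theorem blockColor_lt (hq : 0 < q) (hd : r < d) (n : ℕ) : blockColor q r d n < q * d + r := by
  have hd0 : 0 < d := by omega
  have h := Nat.mod_lt n hd0
  unfold blockColor
  split_ifs with hj
  · have h1 : n / d % (q + 1) ≤ q := Nat.lt_succ_iff.mp (Nat.mod_lt _ (by omega))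
    have := Nat.mul_le_mul_right d h1
    omega
  · have h1 : n / d % q + 1 ≤ q := Nat.mod_lt _ hq
    have := Nat.mul_le_mul_right d h1
    rw [add_mul] at this
    omega

theorem div_bounds_of_mem_edge (hd : r < d) {s j : ℕ} (hj : j < q * d + r) :
    s ≤ (s * d + j) / d ∧ (s * d + j) / d ≤ s + q ∧
      (¬ (s * d + j) % d < r → (s * d + j) / d < s + q) := by
  have hd0 : 0 < d := by omega
  rw [mul_comm s d, Nat.mul_add_div hd0, Nat.mul_add_mod]
  have h1 : j / d ≤ q := by
    have : j < (q + 1) * d := by rw [add_mul, one_mul]; omega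
    exact Nat.lt_succ_iff.mp ((Nat.div_lt_iff_lt_mul hd0).mpr this)
  refine ⟨Nat.le_add_right _ _, Nat.add_le_add_left h1 _, fun h => ?_⟩
  rcases h1.lt_or_eq with h2 | h2
  · omega
  · have := Nat.div_add_mod j d
    rw [h2, mul_comm] at this
    omega

theorem eq_of_mod_eq_of_window {a s x y : ℕ} (hx : s ≤ x) (hx' : x < s + a) (hy : s ≤ y)
    (hy' : y < s + a) (h : x % a = y % a) : x = y := by
  have h1 : x - s ≡ y - s [MOD a] := by
    apply Nat.ModEq.add_left_cancel' s
    rw [Nat.add_sub_cancel' hx, Nat.add_sub_cancel' hy]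
    exact h
  have := h1.eq_of_lt_of_lt (by omega) (by omega)
  omega

theorem blockColor_injOn_edge (hd : r < d) {s i j : ℕ} (hi : i < q * d + r)
    (hj : j < q * d + r) (h : blockColor q r d (s * d + i) = blockColor q r d (s * d + j)) :
    i = j := by
  have hm : (s * d + i) % d = (s * d + j) % d := by
    rw [← blockColor_mod (q := q), h, blockColor_mod]
  have hdv := congrArg (· / d) h
  simp only [blockColor_div hd, hm] at hdv
  obtain ⟨a1, a2, a3⟩ := div_bounds_of_mem_edge hd (s := s) hi
  obtain ⟨b1, b2, b3⟩ := div_bounds_of_mem_edge hd (s := s) hj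
  have key : (s * d + i) / d = (s * d + j) / d := by
    split_ifs at hdv with hc
    · exact eq_of_mod_eq_of_window (s := s) (a := q + 1) a1 (by omega) b1 (by omega) hdv
    · exact eq_of_mod_eq_of_window (s := s) a1 (a3 (by omega)) b1 (b3 hc) hdv
  have e1 := Nat.div_add_mod (s * d + i) d
  have e2 := Nat.div_add_mod (s * d + j) d
  rw [key, hm] at e1
  omega

theorem blockColor_eq_left_iff (hr : 0 < r) (hd : r < d) (n : ℕ) :
    blockColor q r d n = q * d ↔ n % d = 0 ∧ n / d % (q + 1) = q := by
  have hd0 : 0 < d := by omega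
  constructor
  · intro h
    have h1 := blockColor_mod (q := q) (r := r) (d := d) n
    have h2 := blockColor_div (q := q) hd n
    rw [h, Nat.mul_mod_left] at h1
    rw [h, Nat.mul_div_cancel _ hd0, if_pos (by omega)] at h2
    exact ⟨h1.symm, h2.symm⟩
  · rintro ⟨h1, h2⟩
    rw [blockColor, if_pos (by omega), h2, h1, add_zero]

theorem blockColor_eq_right_iff (hd : r < d) (n : ℕ) :
    blockColor q r d n = (q - 1) * d + r ↔ n % d = r ∧ n / d % q = q - 1 := by
  have hd0 : 0 < d := by omega
  constructor
  · intro h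
    have h1 := blockColor_mod (q := q) (r := r) (d := d) n
    have h2 := blockColor_div (q := q) hd n
    rw [h, Nat.mul_add_mod', Nat.mod_eq_of_lt hd] at h1
    rw [h, mul_comm, Nat.mul_add_div hd0, Nat.div_eq_of_lt hd, if_neg (by omega)] at h2
    exact ⟨h1.symm, by omega⟩
  · rintro ⟨h1, h2⟩
    rw [blockColor, if_neg (by omega), h2, h1]

theorem div_eq_div_of_window (hq : 0 < q) {s x y : ℕ} (hx : s ≤ x) (hx' : x ≤ s + q)
    (hy : s ≤ y) (hy' : y < s + q) (hxm : x % (q + 1) = q) (hym : y % q = q - 1) :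
    x / (q * (q + 1)) = y / (q * (q + 1)) := by
  have hT : 0 < q * (q + 1) := by positivity
  have ex := Nat.div_add_mod x (q + 1)
  have ey := Nat.div_add_mod y q
  rw [hxm] at ex
  rw [hym] at ey
  have hx1 : x + 1 = (q + 1) * (x / (q + 1) + 1) := by rw [mul_add]; omega
  have hy1 : y + 1 = q * (y / q + 1) := by rw [mul_add]; omega
  have main : ∀ a, x < a * (q * (q + 1)) ↔ y < a * (q * (q + 1)) := by
    intro a
    constructor
    · intro h
      by_contra! hc
      have : a * (q + 1) * q < (y / q + 1) * q := by
        calc a * (q + 1) * q = a * (q * (q + 1)) := by ring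
          _ < y + 1 := by omega
          _ = _ := by rw [hy1]; ring
      have h2 := Nat.lt_of_mul_lt_mul_right this
      have h3 : (a * (q + 1) + 1) * q ≤ (y / q + 1) * q := Nat.mul_le_mul_right _ h2
      have h4 : (a * (q + 1) + 1) * q = a * (q * (q + 1)) + q := by ring
      have h5 : (y / q + 1) * q = y + 1 := by rw [hy1]; ring
      omega
    · intro h
      by_contra! hc
      have : a * q * (q + 1) < (x / (q + 1) + 1) * (q + 1) := by
        calc a * q * (q + 1) = a * (q * (q + 1)) := by ring
          _ < x + 1 := by omega
          _ = _ := by rw [hx1]; ring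
      have h2 := Nat.lt_of_mul_lt_mul_right this
      have h3 : (a * q + 1) * (q + 1) ≤ (x / (q + 1) + 1) * (q + 1) :=
        Nat.mul_le_mul_right _ h2
      have h4 : (a * q + 1) * (q + 1) = a * (q * (q + 1)) + (q + 1) := by ring
      have h5 : (x / (q + 1) + 1) * (q + 1) = x + 1 := by rw [hx1]; ring
      omega
  apply le_antisymm
  · rw [← Nat.lt_succ_iff, Nat.div_lt_iff_lt_mul hT, main, ← Nat.div_lt_iff_lt_mul hT]
    omega
  · rw [← Nat.lt_succ_iff, Nat.div_lt_iff_lt_mul hT, ← main, ← Nat.div_lt_iff_lt_mul hT]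
    omega

theorem sub_one_mul_add (hq : 0 < q) : (q - 1) * d + d = q * d := by
  rw [← Nat.succ_mul, Nat.succ_eq_add_one, Nat.sub_add_cancel hq]

theorem blockColorSwap_lt (hq : 0 < q) (hr : 0 < r) (hd : r < d) (n : ℕ) :
    blockColorSwap q r d n < q * d + r := by
  have h := blockColor_lt hq hd n
  have h2 : (q - 1) * d ≤ q * d := Nat.mul_le_mul_right _ (by omega)
  have h3 := sub_one_mul_add (d := d) hq
  unfold blockColorSwap
  split_ifs
  · rw [Equiv.swap_apply_def]
    split_ifs <;> omega
  · exact h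

theorem left_ne_right (hq : 0 < q) (hd : r < d) : q * d ≠ (q - 1) * d + r := by
  have h3 := sub_one_mul_add (d := d) hq
  omega

theorem blockColorSwap_injOn_edge (hq : 0 < q) (hr : 0 < r) (hd : r < d) {s i j : ℕ}
    (hi : i < q * d + r) (hj : j < q * d + r)
    (h : blockColorSwap q r d (s * d + i) = blockColorSwap q r d (s * d + j)) : i = j := by
  have status : ∀ i j, i < q * d + r → j < q * d + r →
      blockColor q r d (s * d + i) = q * d → blockColor q r d (s * d + j) = (q - 1) * d + r →
      (s * d + i) / d / (q * (q + 1)) = (s * d + j) / d / (q * (q + 1)) := by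
    intro i j hi hj h1 h2
    obtain ⟨a1, a2, a3⟩ := div_bounds_of_mem_edge hd (s := s) hi
    obtain ⟨b1, b2, b3⟩ := div_bounds_of_mem_edge hd (s := s) hj
    rw [blockColor_eq_left_iff hr hd] at h1
    rw [blockColor_eq_right_iff hd] at h2
    exact div_eq_div_of_window hq a1 a2 b1 (b3 (by omega)) h1.2 h2.2
  have mixed : ∀ i j, i < q * d + r → j < q * d + r →
      (s * d + i) / d / (q * (q + 1)) % 2 = 0 → ¬ (s * d + j) / d / (q * (q + 1)) % 2 = 0 →
      Equiv.swap (q * d) ((q - 1) * d + r) (blockColor q r d (s * d + i)) =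
        blockColor q r d (s * d + j) → i = j := by
    intro i j hi hj hs ht h
    rw [Equiv.swap_apply_def] at h
    split_ifs at h with c1 c2
    · have := status i j hi hj c1 h.symm
      rw [this] at hs
      exact absurd hs ht
    · have := status j i hj hi h.symm c2
      rw [← this] at hs
      exact absurd hs ht
    · exact blockColor_injOn_edge hd hi hj h
  unfold blockColorSwap at h
  split_ifs at h with h1 h2 h2
  · exact blockColor_injOn_edge hd hi hj ((Equiv.swap _ _).injective h)
  · exact mixed i j hi hj h1 h2 h
  · exact (mixed j i hj hi h2 h1 h.symm).symm
  · exact blockColor_injOn_edge hd hi hj h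

theorem blockColor_mod_period (n : ℕ) :
    blockColor q r d (n % (d * (q * (q + 1) * 2))) = blockColor q r d n := by
  have h1 : n % (d * (q * (q + 1) * 2)) % d = n % d := Nat.mod_mul_right_mod _ _ _
  have h2 : n % (d * (q * (q + 1) * 2)) / d = n / d % (q * (q + 1) * 2) :=
    Nat.mod_mul_right_div_self _ _ _
  unfold blockColor
  rw [h1, h2, Nat.mod_mod_of_dvd]
  split_ifs
  · exact ⟨q * 2, by ring⟩
  · exact ⟨(q + 1) * 2, by ring⟩

theorem blockColorSwap_mod_period (n : ℕ) :
    blockColorSwap q r d (n % (d * (q * (q + 1) * 2))) = blockColorSwap q r d n := by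
  have h2 : n % (d * (q * (q + 1) * 2)) / d / (q * (q + 1)) % 2 = n / d / (q * (q + 1)) % 2 := by
    rw [Nat.mod_mul_right_div_self, Nat.mod_mul_right_div_self, Nat.mod_mod]
  unfold blockColorSwap
  rw [h2, blockColor_mod_period]

theorem card_filter_offset_residue {a b ρ j : ℕ} (hρ : ρ < a) (hj : j < d) :
    ((Finset.range (d * (a * b))).filter fun n => n % d = j ∧ n / d % a = ρ).card = b := by
  have hd0 : 0 < d := by omega
  have ha0 : 0 < a := by omega
  conv_rhs => rw [← Finset.card_range b]
  refine Finset.card_nbij' (fun n => n / d / a) (fun t => d * (a * t + ρ) + j) ?_ ?_ ?_ ?_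
  · intro n hn
    simp only [Finset.coe_filter, Finset.mem_range, Set.mem_ofPred_eq, Finset.coe_range,
      Set.mem_Iio] at hn ⊢
    rw [Nat.div_lt_iff_lt_mul ha0, Nat.div_lt_iff_lt_mul hd0]
    calc n < _ := hn.1
      _ = _ := by ring
  · intro t ht
    simp only [Finset.coe_filter, Finset.mem_range, Set.mem_ofPred_eq, Finset.coe_range,
      Set.mem_Iio] at ht ⊢
    refine ⟨?_, by rw [Nat.mul_add_mod, Nat.mod_eq_of_lt hj], ?_⟩
    · have h1 : a * (t + 1) ≤ a * b := Nat.mul_le_mul_left _ ht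
      have h2 : a * t + ρ + 1 ≤ a * b := by rw [mul_add] at h1; omega
      have h3 := Nat.mul_le_mul_left d h2
      rw [mul_add d (a * t + ρ) 1] at h3
      omega
    · rw [Nat.mul_add_div hd0, Nat.div_eq_of_lt hj, add_zero, Nat.mul_add_mod,
        Nat.mod_eq_of_lt hρ]
  · intro n hn
    simp only [Finset.coe_filter, Finset.mem_range, Set.mem_ofPred_eq] at hn
    have e1 := Nat.div_add_mod n d
    have e2 := Nat.div_add_mod (n / d) a
    rw [hn.2.1] at e1
    rw [hn.2.2] at e2
    simp only [e2, e1]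
  · intro t ht
    simp only
    rw [Nat.mul_add_div hd0, Nat.div_eq_of_lt hj, add_zero, Nat.mul_add_div ha0,
      Nat.div_eq_of_lt hρ, add_zero]

theorem sum_blockColorSwap_sub (hq : 0 < q) (hr : 0 < r) (hd : r < d) (w : ℕ → ℤ) :
    ∑ n ∈ Finset.range (d * (q * (q + 1) * 2)), w (blockColorSwap q r d n) -
      ∑ n ∈ Finset.range (d * (q * (q + 1) * 2)), w (blockColor q r d n) =
      w (q * d) - w ((q - 1) * d + r) := by
  have hd0 : 0 < d := by omega
  have hne := left_ne_right hq hd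
  have hT : 0 < q * (q + 1) := by positivity
  rw [← Finset.sum_sub_distrib]
  have hsub : Finset.range (d * (q * (q + 1))) ⊆ Finset.range (d * (q * (q + 1) * 2)) := by
    apply Finset.range_subset_range.mpr
    apply Nat.mul_le_mul_left
    omega
  rw [← Finset.sum_subset hsub]
  · have hpt : ∀ n ∈ Finset.range (d * (q * (q + 1))),
        w (blockColorSwap q r d n) - w (blockColor q r d n) =
          ((if n % d = r ∧ n / d % q = q - 1 then 1 else 0) -
            (if n % d = 0 ∧ n / d % (q + 1) = q then 1 else 0)) *
            (w (q * d) - w ((q - 1) * d + r)) := by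
      intro n hn
      have hz : n / d / (q * (q + 1)) = 0 := by
        apply Nat.div_eq_of_lt
        rw [Nat.div_lt_iff_lt_mul hd0, mul_comm]
        exact Finset.mem_range.mp hn
      simp only [← blockColor_eq_left_iff hr hd, ← blockColor_eq_right_iff hd, blockColorSwap,
        hz, Nat.zero_mod, if_true]
      rw [Equiv.swap_apply_def]
      split_ifs with h1 h2 h3
      · exact absurd (h1.symm.trans h2) hne
      · rw [h1]; ring
      · rw [h3]; ring
      · ring
    rw [Finset.sum_congr rfl hpt, ← Finset.sum_mul, Finset.sum_sub_distrib, Finset.sum_boole,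
      Finset.sum_boole, card_filter_offset_residue (a := q) (b := q + 1) (by omega) hd,
      mul_comm q (q + 1), card_filter_offset_residue (a := q + 1) (b := q) (by omega) hd0]
    push_cast
    ring
  · intro n hn hn'
    simp only [Finset.mem_range, not_lt] at hn hn'
    have h1 : n / d / (q * (q + 1)) = 1 := by
      rw [Nat.div_div_eq_div_mul]
      apply Nat.div_eq_of_lt_le
      · omega
      · calc n < _ := hn
          _ = _ := by ring
    simp [blockColorSwap, h1]

theorem exists_rainbow_pair (hq : 0 < q) (hr : 0 < r) (hd : r < d) {k M : ℕ}
    (hk : k = q * d + r) (hM : M = d * (q * (q + 1) * 2)) :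
    ∃ c₁ c₂ : ℕ → Fin k, ∃ α β : Fin k, IsRainbow k d M c₁ ∧ IsRainbow k d M c₂ ∧ α ≠ β ∧
      ∀ w : Fin k → ℤ, ∑ n ∈ Finset.range M, w (c₂ n) - ∑ n ∈ Finset.range M, w (c₁ n) =
        w α - w β := by
  subst hk hM
  have h3 := sub_one_mul_add (d := d) hq
  refine ⟨fun n => ⟨blockColor q r d n, blockColor_lt hq hd n⟩,
    fun n => ⟨blockColorSwap q r d n, blockColorSwap_lt hq hr hd n⟩,
    ⟨q * d, by omega⟩, ⟨(q - 1) * d + r, by omega⟩, ⟨?_, ?_⟩, ⟨?_, ?_⟩, ?_, ?_⟩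
  · intro n
    simp only [blockColor_mod_period]
  · intro s i j h
    simp only [Fin.mk.injEq] at h
    exact Fin.ext (blockColor_injOn_edge hd i.2 j.2 h)
  · intro n
    simp only [blockColorSwap_mod_period]
  · intro s i j h
    simp only [Fin.mk.injEq] at h
    exact Fin.ext (blockColorSwap_injOn_edge hq hr hd i.2 j.2 h)
  · simpa using left_ne_right hq hd
  · intro w
    have h := sum_blockColorSwap_sub hq hr hd
      (fun n => if h : n < q * d + r then w ⟨n, h⟩ else 0)
    simpa [blockColor_lt hq hd, blockColorSwap_lt hq hr hd,
      show (q - 1) * d + r < q * d + r by omega, hr] using h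

end Colouring

section Cycle

variable {k ℓ M : ℕ} {c : ℕ → Fin k}

/-- The number of vertices in a preimage under a colouring of `ZMod M`, as a sum over `range M`. -/
theorem ncard_preimage_eq_sum [NeZero M] (g : Fin k → ℕ) (x : ℕ) :
    ((((fun p : ZMod M => g (c p.val)) ⁻¹' {x}).ncard : ℕ) : ℤ) =
      ∑ n ∈ Finset.range M, if g (c n) = x then 1 else 0 := by
  rw [Finset.sum_boole, Nat.cast_inj]
  have : ((fun p : ZMod M => g (c p.val)) ⁻¹' {x}).ncard =
      (ZMod.val '' ((fun p : ZMod M => g (c p.val)) ⁻¹' {x})).ncard :=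
    (Set.ncard_image_of_injective _ (ZMod.val_injective M)).symm
  rw [this, ← Set.ncard_coe_finset]
  congr 1
  ext n
  simp only [Set.mem_image, Set.mem_preimage, Set.mem_singleton_iff, Finset.coe_filter,
    Finset.mem_range, Set.mem_ofPred_eq]
  constructor
  · rintro ⟨p, hp, rfl⟩
    exact ⟨ZMod.val_lt p, hp⟩
  · rintro ⟨h1, h2⟩
    exact ⟨(n : ZMod M), by rwa [ZMod.val_cast_of_lt h1], ZMod.val_cast_of_lt h1⟩

theorem IsRainbow.image_edge (hc : IsRainbow k (k - ℓ) M c) {e : Finset (ZMod M)}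
    (he : e ∈ cycleGraph k ℓ M) : e.image (fun p => c p.val) = Finset.univ := by
  simp only [cycleGraph, Finset.mem_image] at he
  obtain ⟨s, -, rfl⟩ := he
  rw [Finset.image_image]
  apply Finset.image_univ_of_surjective
  apply Finite.surjective_of_injective
  intro i j h
  simp only [Function.comp, ZMod.val_natCast, hc.1] at h
  exact hc.2 s h

theorem IsRainbow.card_edge_inter [NeZero M] (hc : IsRainbow k (k - ℓ) M c) {e : Finset (ZMod M)}
    (he : e ∈ cycleGraph k ℓ M) (i : Fin k) :
    (e ∩ Finset.univ.filter fun p : ZMod M => c p.val = i).card = 1 := by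
  have himg := hc.image_edge he
  have hcard : e.card ≤ k := by
    simp only [cycleGraph, Finset.mem_image] at he
    obtain ⟨s, -, rfl⟩ := he
    exact Finset.card_image_le.trans (by simp)
  have hinj : Set.InjOn (fun p : ZMod M => c p.val) e := by
    rw [← Finset.card_image_iff]
    refine le_antisymm Finset.card_image_le ?_
    rw [himg]
    simpa using hcard
  obtain ⟨p, hp, hpi⟩ := Finset.mem_image.mp (himg ▸ Finset.mem_univ i)
  rw [Finset.card_eq_one]
  refine ⟨p, Finset.ext fun x => ?_⟩
  simp only [Finset.mem_inter, Finset.mem_filter, Finset.mem_univ, true_and,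
    Finset.mem_singleton]
  constructor
  · rintro ⟨hx, hxi⟩
    exact hinj hx hp (hxi.trans hpi.symm)
  · rintro rfl
    exact ⟨hp, hpi⟩

theorem IsRainbow.image_edge_equiv (hc : IsRainbow k (k - ℓ) M c) {f : Finset ℕ}
    (g : Fin k ≃ f) {e : Finset (ZMod M)} (he : e ∈ cycleGraph k ℓ M) :
    e.image (fun p => (g (c p.val) : ℕ)) = f := by
  have : e.image (fun p => (g (c p.val) : ℕ)) =
      (e.image fun p => c p.val).image fun i => (g i : ℕ) := by
    rw [Finset.image_image]; rfl
  rw [this, hc.image_edge he]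
  ext x
  simp only [Finset.mem_image, Finset.mem_univ, true_and]
  constructor
  · rintro ⟨i, rfl⟩
    exact (g i).2
  · intro hx
    exact ⟨g.symm ⟨x, hx⟩, by simp⟩

end Cycle

/-- A subgroup of `ι → ℤ` containing all differences of unit vectors contains all vectors of
coordinate sum zero. -/
theorem mem_of_sum_eq_zero {ι : Type*} [Fintype ι] [DecidableEq ι] (L : AddSubgroup (ι → ℤ))
    (h : ∀ u v : ι, Pi.single u (1 : ℤ) - Pi.single v 1 ∈ L) (b : ι → ℤ)
    (hb : ∑ v, b v = 0) : b ∈ L := by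
  rcases isEmpty_or_nonempty ι with hι | ⟨⟨v₀⟩⟩
  · rw [Subsingleton.elim b 0]
    exact L.zero_mem
  have hb' : b = ∑ v, b v • (Pi.single v (1 : ℤ) - Pi.single v₀ 1 : ι → ℤ) := by
    simp only [smul_sub, Finset.sum_sub_distrib, ← Finset.sum_smul, hb, zero_smul, sub_zero]
    ext x
    simp [Finset.sum_apply, Pi.single_apply]
  rw [hb']
  exact L.sum_mem fun v _ => L.zsmul_mem (h v v₀) _

/-- In an `ℓ`-connected hypergraph with `1 ≤ ℓ`, a subgroup containing the difference of the unit
vectors of any two vertices in a common edge contains this difference for any two vertices. -/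
theorem LConn.single_sub_single_mem {k ℓ : ℕ} {R : HG} (hℓ : 1 ≤ ℓ) (hR : R.IsUniform k)
    (hconn : LConn ℓ R) (L : AddSubgroup ({x : ℕ // x ∈ R.verts} → ℤ))
    (h : ∀ e ∈ R.edges, ∀ u v : {x : ℕ // x ∈ R.verts}, (u : ℕ) ∈ e → (v : ℕ) ∈ e →
      Pi.single u (1 : ℤ) - Pi.single v 1 ∈ L) (u v : {x : ℕ // x ∈ R.verts}) :
    Pi.single u (1 : ℤ) - Pi.single v 1 ∈ L := by
  obtain ⟨e, he, hue⟩ := hconn.1 u u.2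
  obtain ⟨f, hf, hvf⟩ := hconn.1 v v.2
  have key : ∀ f, Relation.ReflTransGen
      (fun a b => a ∈ R.edges ∧ b ∈ R.edges ∧ ℓ ≤ (a ∩ b).card) e f →
      ∀ v : {x : ℕ // x ∈ R.verts}, (v : ℕ) ∈ f → Pi.single u (1 : ℤ) - Pi.single v 1 ∈ L := by
    intro f hef
    induction hef with
    | refl => exact fun v hv => h e he u v hue hv
    | @tail a b _ hab ih =>
      intro v hv
      obtain ⟨ha, hb, hc⟩ := hab
      obtain ⟨x, hx⟩ : (a ∩ b).Nonempty := Finset.card_pos.mp (by omega)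
      rw [Finset.mem_inter] at hx
      have h1 := ih ⟨x, (hR a ha).1 hx.1⟩ hx.1
      have h2 := h b hb ⟨x, (hR a ha).1 hx.1⟩ v hx.2 hv
      simpa using L.add_mem h1 h2
  exact key f (hconn.2 e he f hf) v hvf

/-- **Lemma (lattice completeness).** Let `1 ≤ ℓ ≤ k - 1` with `k - ℓ ∤ k`, and let
`R` be an `ℓ`-connected `k`-graph.  Then there is a `k`-uniform `ℓ`-cycle `C` with at
most `k⁴` edges (i.e. on `M ≤ k⁴(k-ℓ)` vertices) which is `k`-partite and whose
lattice `L_C(R)` is complete: it contains every integer vector on `V(R)` whose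
coordinate sum is divisible by `v(C) = M`. -/
theorem lattice_completeness (k ℓ : ℕ) (hℓ1 : 1 ≤ ℓ) (hℓ2 : ℓ ≤ k - 1)
    (hnd : ¬ (k - ℓ) ∣ k) (R : HG) (hR : R.IsUniform k) (hconn : LConn ℓ R) :
    ∃ M : ℕ, (k - ℓ) ∣ M ∧ 2 * k - ℓ ≤ M ∧ M ≤ k ^ 4 * (k - ℓ) ∧
      (∃ P : Fin k → Finset (ZMod M),
        (∀ i j : Fin k, i ≠ j → Disjoint (P i) (P j)) ∧
        (∀ v : ZMod M, ∃ i : Fin k, v ∈ P i) ∧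
        (∀ e ∈ cycleGraph k ℓ M, ∀ i : Fin k, (e ∩ P i).card = 1)) ∧
      (∀ b : {x : ℕ // x ∈ R.verts} → ℤ,
        (M : ℤ) ∣ (∑ v : {x : ℕ // x ∈ R.verts}, b v) →
        b ∈ AddSubgroup.closure
          {f : {x : ℕ // x ∈ R.verts} → ℤ |
            ∃ φ : ZMod M → ℕ, (∀ e ∈ cycleGraph k ℓ M, e.image φ ∈ R.edges) ∧
              ∀ v : {x : ℕ // x ∈ R.verts}, f v = ((φ ⁻¹' {(v : ℕ)}).ncard : ℤ)}) := by
  classical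
  obtain ⟨d, hd⟩ : ∃ d, d = k - ℓ := ⟨_, rfl⟩
  obtain ⟨q, hq⟩ : ∃ q, q = k / d := ⟨_, rfl⟩
  obtain ⟨r, hr⟩ : ∃ r, r = k % d := ⟨_, rfl⟩
  obtain ⟨M, hM⟩ : ∃ M, M = d * (q * (q + 1) * 2) := ⟨_, rfl⟩
  have hd0 : 0 < d := by omega
  have hdk : d < k := by omega
  have hq0 : 0 < q := hq ▸ Nat.div_pos hdk.le hd0
  have hr0 : 0 < r := by
    rw [← hd] at hnd
    rw [hr]
    exact Nat.pos_of_ne_zero fun h => hnd (Nat.dvd_of_mod_eq_zero h)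
  have hrd : r < d := hr ▸ Nat.mod_lt _ hd0
  have hk : k = q * d + r := by rw [hq, hr, mul_comm, Nat.div_add_mod]
  have hM0 : 0 < M := by rw [hM]; positivity
  have : NeZero M := ⟨hM0.ne'⟩
  obtain ⟨c₁, c₂, α, β, hc₁, hc₂, hαβ, hsum⟩ := exists_rainbow_pair hq0 hr0 hrd hk hM
  rw [hd] at hc₁ hc₂
  refine ⟨M, ⟨q * (q + 1) * 2, by rw [hM, hd]⟩, ?_, ?_, ?_, ?_⟩
  · have h1 : (q + 1) * 2 ≤ q * (q + 1) * 2 := by nlinarith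
    have h2 := Nat.mul_le_mul_left d h1
    have h3 : d * ((q + 1) * 2) = q * d + q * d + d + d := by ring
    omega
  · rw [← hd, hM, mul_comm]
    apply Nat.mul_le_mul_right
    have hqk : q + 1 ≤ k := by
      have : q * 1 ≤ q * d := Nat.mul_le_mul_left _ hd0
      omega
    have hk2 : 2 ≤ k := by omega
    calc q * (q + 1) * 2 ≤ k * k * k := by gcongr; omega
      _ ≤ k * k * k * k := Nat.le_mul_of_pos_right _ (by omega)
      _ = k ^ 4 := by ring
  · refine ⟨fun i => Finset.univ.filter fun p : ZMod M => c₁ p.val = i, ?_, ?_, ?_⟩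
    · intro i j hij
      rw [Finset.disjoint_left]
      intro p hp hp'
      simp only [Finset.mem_filter, Finset.mem_univ, true_and] at hp hp'
      exact hij (hp.symm.trans hp')
    · intro v
      exact ⟨c₁ v.val, by simp⟩
    · intro e he i
      convert hc₁.card_edge_inter he i
  · intro b hb
    set L := AddSubgroup.closure
          {f : {x : ℕ // x ∈ R.verts} → ℤ |
            ∃ φ : ZMod M → ℕ, (∀ e ∈ cycleGraph k ℓ M, e.image φ ∈ R.edges) ∧
              ∀ v : {x : ℕ // x ∈ R.verts}, f v = ((φ ⁻¹' {(v : ℕ)}).ncard : ℤ)}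
    have hmem : ∀ f ∈ R.edges, ∀ g : Fin k ≃ f, ∀ c, IsRainbow k (k - ℓ) M c →
        (fun v : {x : ℕ // x ∈ R.verts} =>
          ∑ n ∈ Finset.range M, if (g (c n) : ℕ) = v then (1 : ℤ) else 0) ∈ L := by
      intro f hf g c hc
      apply AddSubgroup.subset_closure
      refine ⟨fun p => (g (c p.val) : ℕ), ?_, ?_⟩
      · intro e he
        rw [hc.image_edge_equiv g he]
        exact hf
      · intro v
        exact (ncard_preimage_eq_sum (fun i => (g i : ℕ)) v).symm
    have hedge : ∀ e ∈ R.edges, ∀ u v : {x : ℕ // x ∈ R.verts}, (u : ℕ) ∈ e → (v : ℕ) ∈ e →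
        Pi.single u (1 : ℤ) - Pi.single v 1 ∈ L := by
      intro e he u v hu hv
      rcases eq_or_ne u v with rfl | huv
      · rw [sub_self]
        exact L.zero_mem
      obtain ⟨g, hg⟩ := Finset.exists_equiv_extend_of_card_eq (α := Fin k) (t := e)
        (by simp [(hR e he).2]) (s := {α, β}) (f := fun i => if i = α then (u : ℕ) else v)
        (by
          intro x hx
          simp only [Finset.mem_image] at hx
          obtain ⟨i, -, rfl⟩ := hx
          split_ifs <;> assumption)
        (by
          have huv' : (u : ℕ) ≠ v := fun h => huv (Subtype.ext h)
          intro i hi j hj hij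
          simp only [Finset.coe_insert, Finset.coe_singleton, Set.mem_insert_iff,
            Set.mem_singleton_iff] at hi hj
          rcases hi with rfl | rfl <;> rcases hj with rfl | rfl
          · rfl
          · simp [hαβ.symm, huv'] at hij
          · simp [hαβ.symm, huv'.symm] at hij
          · rfl)
      have hα : (g α : ℕ) = u := by simpa using hg α (by simp)
      have hβ : (g β : ℕ) = v := by simpa [hαβ.symm] using hg β (by simp)
      convert L.sub_mem (hmem e he g c₂ hc₂) (hmem e he g c₁ hc₁) using 1
      funext x
      have := hsum fun i => if (g i : ℕ) = x then (1 : ℤ) else 0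
      rw [hα, hβ] at this
      simp only [Pi.sub_apply, this, Pi.single_apply, Subtype.ext_iff, eq_comm (a := (x : ℕ))]
    have hall := hconn.single_sub_single_mem hℓ1 hR L hedge
    rcases isEmpty_or_nonempty {x : ℕ // x ∈ R.verts} with hι | ⟨⟨v₀⟩⟩
    · rw [Subsingleton.elim b 0]
      exact L.zero_mem
    obtain ⟨e, he, -⟩ := hconn.1 v₀ v₀.2
    let g : Fin k ≃ e := (e.equivFinOfCardEq (hR e he).2).symm
    have hf := hmem e he g c₁ hc₁
    set f := fun v : {x : ℕ // x ∈ R.verts} =>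
          ∑ n ∈ Finset.range M, if (g (c₁ n) : ℕ) = v then (1 : ℤ) else 0 with hf'
    have hfs : ∑ v, f v = M := by
      rw [hf', Finset.sum_comm]
      have : ∀ n ∈ Finset.range M,
          ∑ v : {x : ℕ // x ∈ R.verts}, (if (g (c₁ n) : ℕ) = v then (1 : ℤ) else 0) = 1 := by
        intro n _
        have hx : (g (c₁ n) : ℕ) ∈ R.verts := (hR e he).1 (g (c₁ n)).2
        rw [Finset.sum_eq_single ⟨_, hx⟩]
        · simp
        · intro v _ hv
          exact if_neg fun h => hv (Subtype.ext h.symm)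
        · simp
      rw [Finset.sum_congr rfl this]
      simp
    obtain ⟨t, ht⟩ := hb
    have h0 : b - t • f ∈ L := by
      apply mem_of_sum_eq_zero L hall
      simp only [Pi.sub_apply, Pi.smul_apply, Finset.sum_sub_distrib, smul_eq_mul,
        ← Finset.mul_sum, hfs, ht]
      ring
    simpa using L.add_mem h0 (L.zsmul_mem hf t)
end

section
/- Let k, n ≥ 1, ε > 0 and q ≥ 2. Let H be a qk-uniform hypergraph on qn vertices, and let Q = {B₁, …, B_n} be a partition of V(H) into n sets of size q chosen uniformly at random among all such partitions. Then with probability at least 1 − 2·exp(−ε²n/(16q)), the squashed k-graph H_Q satisfies |E(H_Q)| ≥ (C(n,k)/C(qn,qk))·|E(H)| − ε·n^k. -/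
open ProbabilityTheory MeasureTheory in
theorem sum_exp_le_of_abs_sub_le {ι : Type*} [Fintype ι] [Nonempty ι]
    (m : ι → ℝ) (a c t : ℝ) (hm : ∀ i, |m i - a| ≤ c) :
    ∑ i, Real.exp (t * m i) ≤
      Fintype.card ι * Real.exp (t * ((∑ i, m i) / Fintype.card ι) + t ^ 2 * c ^ 2 / 2) := by
  let _ : MeasurableSpace ι := ⊤
  have _ : MeasurableSingletonClass ι := ⟨fun _ => trivial⟩
  have hcard : (0 : ℝ) < Fintype.card ι := by exact_mod_cast Fintype.card_pos
  have hc : 0 ≤ c := (abs_nonneg _).trans (hm (Classical.arbitrary ι))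
  let P := (PMF.uniformOfFintype ι).toMeasure
  have hint (f : ι → ℝ) : ∫ i, f i ∂P = (∑ i, f i) / Fintype.card ι := by
    rw [PMF.integral_eq_sum]
    simp [div_eq_inv_mul, Finset.mul_sum]
  have hsub := hasSubgaussianMGF_of_mem_Icc (μ := P) (X := m) (a := a - c) (b := a + c)
    (measurable_from_top.aemeasurable) (Filter.Eventually.of_forall fun i => by
      have := abs_le.mp (hm i)
      constructor <;> linarith)
  have h := hsub.mgf_le t
  rw [mgf, hint, hint] at h
  have hexp (i : ι) : Real.exp (t * m i) =
      Real.exp (t * ((∑ i, m i) / Fintype.card ι)) *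
        Real.exp (t * (m i - (∑ i, m i) / Fintype.card ι)) := by
    rw [← Real.exp_add]; ring_nf
  simp_rw [fun i => hexp i, ← Finset.mul_sum]
  rw [div_le_iff₀ hcard] at h
  refine (mul_le_mul_of_nonneg_left h (Real.exp_pos _).le).trans_eq ?_
  rw [Real.exp_add]
  have : ((‖a + c - (a - c)‖₊ / 2) ^ 2 : NNReal) * t ^ 2 / 2 = t ^ 2 * c ^ 2 / 2 := by
    have : a + c - (a - c) = 2 * c := by ring
    rw [this]
    push_cast
    rw [Real.norm_of_nonneg (by positivity)]
    ring
  rw [this]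
  ring

open Equiv in
theorem sum_exp_perm_le (N : ℕ) (g : Perm (Fin N) → ℝ) (c t : ℝ)
    (hg : ∀ σ a b, |g (σ * swap a b) - g σ| ≤ c) :
    ∑ σ, Real.exp (t * g σ) ≤
      N.factorial * Real.exp (t * ((∑ σ, g σ) / N.factorial) + N * (t ^ 2 * c ^ 2 / 2)) := by
  induction N with
  | zero => simp
  | succ N ih =>
    have hsum (f : Perm (Fin (N + 1)) → ℝ) :
        ∑ σ, f σ = ∑ p, ∑ e : Perm (Fin N), f (Perm.decomposeFin.symm (p, e)) := by
      rw [← Perm.decomposeFin.symm.sum_comp, Fintype.sum_prod_type]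
    have hf : (0 : ℝ) < N.factorial := by exact_mod_cast N.factorial_pos
    have hswap (p : Fin (N + 1)) (e : Perm (Fin N)) (a b : Fin N) :
        Perm.decomposeFin.symm (p, e * swap a b) =
          Perm.decomposeFin.symm (p, e) * swap a.succ b.succ := by
      ext x
      refine Fin.cases ?_ (fun y => ?_) x
      · simp [swap_apply_of_ne_of_ne (Fin.succ_ne_zero a).symm (Fin.succ_ne_zero b).symm]
      · simp only [Perm.decomposeFin_symm_apply_succ, Perm.mul_apply,
          ← (Fin.succ_injective N).map_swap a b y]
    have hzero (p : Fin (N + 1)) (e : Perm (Fin N)) :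
        |g (Perm.decomposeFin.symm (p, e)) - g (Perm.decomposeFin.symm (0, e))| ≤ c := by
      set τ := Perm.decomposeFin.symm ((0 : Fin (N + 1)), e)
      have : Perm.decomposeFin.symm (p, e) = τ * swap (τ⁻¹ 0) (τ⁻¹ p) := by
        rw [mul_swap_eq_swap_mul]
        ext x
        refine Fin.cases ?_ (fun y => ?_) x <;> simp [τ]
      rw [this]
      exact hg _ _ _
    let m : Fin (N + 1) → ℝ := fun p =>
      (∑ e : Perm (Fin N), g (Perm.decomposeFin.symm (p, e))) / N.factorial
    have hm (p : Fin (N + 1)) : |m p - m 0| ≤ c := by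
      simp only [m]
      rw [← sub_div, ← Finset.sum_sub_distrib, abs_div, abs_of_pos hf, div_le_iff₀ hf]
      refine (Finset.abs_sum_le_sum_abs _ _).trans
        ((Finset.sum_le_sum fun e _ => hzero p e).trans_eq ?_)
      simp [Fintype.card_perm, mul_comm]
    have h1 := fun p => ih (fun e => g (Perm.decomposeFin.symm (p, e)))
      (fun σ a b => by rw [hswap]; exact hg _ _ _)
    have h2 := sum_exp_le_of_abs_sub_le m (m 0) c t hm
    have hmean : (∑ p, m p) / (N + 1 : ℕ) = (∑ σ, g σ) / (N + 1).factorial := by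
      simp only [m]
      rw [← Finset.sum_div, ← hsum, Nat.factorial_succ, div_div]
      push_cast
      ring
    rw [Fintype.card_fin, hmean] at h2
    rw [hsum]
    refine (Finset.sum_le_sum fun p _ => h1 p).trans ?_
    simp_rw [Real.exp_add, ← mul_assoc, ← Finset.sum_mul, ← Finset.mul_sum]
    refine (mul_le_mul_of_nonneg_right (mul_le_mul_of_nonneg_left h2 hf.le)
      (Real.exp_pos _).le).trans_eq ?_
    rw [Real.exp_add, Nat.factorial_succ]
    push_cast
    rw [add_mul _ _ (t ^ 2 * c ^ 2 / 2), Real.exp_add, one_mul]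
    ring

open Equiv in
theorem card_perm_lt_sub_le (N : ℕ) (hN : 0 < N) (g : Perm (Fin N) → ℝ) (c s μ : ℝ) (hc : 0 < c)
    (hs : 0 ≤ s) (hg : ∀ σ a b, |g (σ * swap a b) - g σ| ≤ c) (hμ : ∑ σ, g σ = N.factorial * μ) :
    ((Finset.univ.filter fun σ => g σ < μ - s).card : ℝ) ≤
      N.factorial * Real.exp (-s ^ 2 / (2 * N * c ^ 2)) := by
  have hN' : (0 : ℝ) < N := by exact_mod_cast hN
  have hf : (0 : ℝ) < N.factorial := by exact_mod_cast N.factorial_pos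
  set t : ℝ := -s / (N * c ^ 2) with ht
  have ht0 : t ≤ 0 := by
    rw [ht, neg_div]; exact neg_nonpos.mpr (by positivity)
  have h := sum_exp_perm_le N g c t hg
  rw [hμ, mul_div_cancel_left₀ _ hf.ne'] at h
  have h1 : ((Finset.univ.filter fun σ => g σ < μ - s).card : ℝ) * Real.exp (t * (μ - s)) ≤
      ∑ σ, Real.exp (t * g σ) := by
    rw [← nsmul_eq_mul]
    refine (Finset.card_nsmul_le_sum _ _ _ fun σ hσ => ?_).trans
      (Finset.sum_le_sum_of_subset_of_nonneg (Finset.filter_subset _ _)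
        fun _ _ _ => (Real.exp_pos _).le)
    exact Real.exp_le_exp.mpr (mul_le_mul_of_nonpos_left (Finset.mem_filter.mp hσ).2.le ht0)
  have h2 := h1.trans h
  rw [← le_div_iff₀ (Real.exp_pos _), mul_div_assoc, ← Real.exp_sub] at h2
  refine h2.trans_eq ?_
  congr 2
  rw [ht]
  field_simp
  ring

open Equiv in
theorem exists_perm_comp_eq {α β : Type*} [Fintype α] [DecidableEq β] (f f' : α → β)
    (h : ∀ b, (Finset.univ.filter fun a => f a = b).card =
      (Finset.univ.filter fun a => f' a = b).card) :
    ∃ τ : Perm α, f' ∘ τ = f := by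
  have e (b : β) : {a // f a = b} ≃ {a // f' a = b} :=
    Fintype.equivOfCardEq (by rw [Fintype.card_subtype, Fintype.card_subtype, h])
  exact ⟨Equiv.ofFiberEquiv e, funext fun a => Equiv.ofFiberEquiv_map e a⟩

open Equiv in
theorem card_perm_filter_comp {α β : Type*} [Fintype α] [DecidableEq α] [Fintype β]
    [DecidableEq β] (f₀ : α → β) (P : (α → β) → Prop) [DecidablePred P] :
    (Finset.univ.filter fun σ : Perm α => P (f₀ ∘ σ)).card =
      (Finset.univ.filter fun σ : Perm α => f₀ ∘ σ = f₀).card *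
      (Finset.univ.filter fun f : α → β => (∀ b, (Finset.univ.filter fun a => f a = b).card =
        (Finset.univ.filter fun a => f₀ a = b).card) ∧ P f).card := by
  classical
  rw [Finset.card_eq_sum_card_fiberwise (f := fun σ : Perm α => f₀ ∘ σ)
    (t := Finset.univ.filter fun f : α → β => (∀ b, (Finset.univ.filter fun a => f a = b).card =
        (Finset.univ.filter fun a => f₀ a = b).card) ∧ P f), mul_comm, ← smul_eq_mul]
  · refine Finset.sum_const_nat fun f hf => ?_
    obtain ⟨hf, hP⟩ := (Finset.mem_filter.mp hf).2
    obtain ⟨τ, hτ⟩ := exists_perm_comp_eq f f₀ hf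
    refine Finset.card_nbij' (· * τ⁻¹) (· * τ) ?_ ?_ ?_ ?_
    · intro σ hσ
      simp only [Finset.coe_filter, Finset.mem_filter, Finset.mem_univ, true_and,
        Set.mem_ofPred_eq] at hσ ⊢
      rw [Perm.coe_mul, ← Function.comp_assoc, hσ.2, ← hτ, Function.comp_assoc, ← Perm.coe_mul,
        mul_inv_cancel]
      rfl
    · intro σ hσ
      simp only [Finset.coe_filter, Finset.mem_filter, Finset.mem_univ, true_and,
        Set.mem_ofPred_eq] at hσ ⊢
      have : f₀ ∘ ⇑(σ * τ) = f := by
        rw [Perm.coe_mul, ← Function.comp_assoc, hσ, hτ]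
      exact ⟨this ▸ hP, this⟩
    · intro σ _; simp
    · intro σ _; simp
  · intro σ hσ
    simp only [Finset.coe_filter, Finset.mem_univ, true_and, Set.mem_ofPred_eq] at hσ ⊢
    exact ⟨fun b => Finset.card_equiv σ (by simp), hσ⟩

open Equiv in
theorem card_perm_preimage_mem_mul_choose {α : Type*} [Fintype α] [DecidableEq α] (A : Finset α)
    (H : Finset (Finset α)) (hH : ∀ e ∈ H, e.card = A.card) :
    (Finset.univ.filter fun σ : Perm α => Finset.univ.filter (fun v => σ v ∈ A) ∈ H).card *
      (Fintype.card α).choose A.card = (Fintype.card α).factorial * H.card := by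
  let f₀ : α → Bool := fun a => decide (a ∈ A)
  have key (H : Finset (Finset α)) (hH : ∀ e ∈ H, e.card = A.card) :
      (Finset.univ.filter fun σ : Perm α => Finset.univ.filter (fun v => σ v ∈ A) ∈ H).card =
        (Finset.univ.filter fun σ : Perm α => f₀ ∘ σ = f₀).card * H.card := by
    have h := card_perm_filter_comp f₀ (fun f => Finset.univ.filter (fun v => f v = true) ∈ H)
    simp only [f₀, Function.comp_apply, decide_eq_true_eq] at h
    rw [h]
    congr 1
    refine Finset.card_nbij' (fun f => Finset.univ.filter fun v => f v = true)
      (fun e v => decide (v ∈ e)) ?_ ?_ ?_ ?_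
    · intro f hf
      exact (Finset.mem_filter.mp hf).2.2
    · intro e he
      have he : e ∈ H := he
      have hc := hH e he
      have h1 : (Finset.univ.filter fun a => a ∉ e).card =
          (Finset.univ.filter fun a => a ∉ A).card := by
        rw [← Finset.compl_filter, ← Finset.compl_filter, Finset.card_compl, Finset.card_compl]
        simp [hc]
      simp [he, hc, h1]
    · intro f _
      ext v
      simp
    · intro e _
      simp
  have h1 := key H hH
  have h2 := key (Finset.powersetCard A.card Finset.univ)
    (fun e he => (Finset.mem_powersetCard.mp he).2)
  rw [Finset.card_powersetCard, Finset.card_univ, Finset.filter_true_of_mem, Finset.card_univ,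
    Fintype.card_perm] at h2
  · rw [h1, h2]; ring
  · intro σ _
    rw [Finset.mem_powersetCard]
    exact ⟨Finset.subset_univ _, Finset.card_equiv σ (by simp)⟩

theorem card_filter_mem_powersetCard_le {β : Type*} [Fintype β] [DecidableEq β] (k : ℕ) (i : β) :
    ((Finset.powersetCard k (Finset.univ : Finset β)).filter (i ∈ ·)).card ≤
      Fintype.card β ^ (k - 1) := by
  refine le_trans ?_ (Nat.choose_le_pow (Fintype.card β) (k - 1))
  rw [← Finset.card_univ, ← Finset.card_powersetCard]
  refine Finset.card_le_card_of_injOn (Finset.erase · i) ?_ ?_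
  · intro I hI
    simp only [Finset.coe_filter, Finset.mem_powersetCard, Set.mem_ofPred_eq] at hI
    simp [Finset.card_erase_of_mem hI.2, hI.1.2]
  · intro I hI J hJ h
    rw [← Finset.insert_erase (Finset.mem_filter.mp hI).2,
      ← Finset.insert_erase (Finset.mem_filter.mp hJ).2]
    exact congrArg _ h

/-- The number of `k`-sets of colours of a colouring `f` whose preimage is an edge of `H`, that is,
the number of edges of the hypergraph `H` squashed along the fibres of `f`. -/
def squashCard {α β : Type*} [Fintype α] [DecidableEq α] [Fintype β] [DecidableEq β]
    (H : Finset (Finset α)) (k : ℕ) (f : α → β) : ℕ :=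
  ((Finset.powersetCard k (Finset.univ : Finset β)).filter
    (fun I => Finset.univ.filter (fun v => f v ∈ I) ∈ H)).card

section squashCard

variable {α β : Type*} [Fintype α] [DecidableEq α] [Fintype β] [DecidableEq β]

theorem squashCard_le_add (H : Finset (Finset α)) (k : ℕ) (f f' : α → β) (i j : β)
    (h : ∀ I : Finset β, i ∉ I → j ∉ I → ∀ v, f v ∈ I ↔ f' v ∈ I) :
    squashCard H k f ≤ squashCard H k f' + 2 * Fintype.card β ^ (k - 1) := by
  set S := Finset.powersetCard k (Finset.univ : Finset β)
  have hsub : S.filter (fun I => Finset.univ.filter (fun v => f v ∈ I) ∈ H) ⊆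
      S.filter (fun I => Finset.univ.filter (fun v => f' v ∈ I) ∈ H) ∪
        (S.filter (i ∈ ·) ∪ S.filter (j ∈ ·)) := by
    intro I hI
    rw [Finset.mem_filter] at hI
    simp only [Finset.mem_union, Finset.mem_filter, hI.1, true_and]
    by_contra! hc
    refine hc.1 ?_
    simp_rw [← h I hc.2.1 hc.2.2]
    exact hI.2
  have h1 := Finset.card_le_card hsub
  have h2 := Finset.card_union_le (S.filter (fun I => Finset.univ.filter (fun v => f' v ∈ I) ∈ H))
    (S.filter (i ∈ ·) ∪ S.filter (j ∈ ·))
  have h3 := Finset.card_union_le (S.filter (i ∈ ·)) (S.filter (j ∈ ·))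
  have h4 := card_filter_mem_powersetCard_le k i
  have h5 := card_filter_mem_powersetCard_le k j
  change (S.filter _).card ≤ (S.filter _).card + _
  change (S.filter _).card ≤ _ at h4 h5
  omega

theorem abs_squashCard_comp_swap_sub_le (H : Finset (Finset α)) (k : ℕ) (f : α → β) (a b : α) :
    |(squashCard H k (f ∘ Equiv.swap a b) : ℝ) - squashCard H k f| ≤
      2 * (Fintype.card β : ℝ) ^ (k - 1) := by
  have h (I : Finset β) (ha : f a ∉ I) (hb : f b ∉ I) (v : α) :
      (f ∘ Equiv.swap a b) v ∈ I ↔ f v ∈ I := by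
    rw [Function.comp_apply, Equiv.swap_apply_def]
    split_ifs with h1 h2 <;> simp_all
  have h1 := squashCard_le_add H k _ f _ _ h
  have h2 := squashCard_le_add H k f _ _ _ fun I ha hb v => (h I ha hb v).symm
  rify at h1 h2
  rw [abs_le]
  constructor <;> linarith

theorem sum_squashCard_comp_perm (H : Finset (Finset α)) (k m : ℕ) (f : α → β)
    (hf : ∀ I : Finset β, I.card = k → (Finset.univ.filter fun v => f v ∈ I).card = m)
    (hH : ∀ e ∈ H, e.card = m) :
    ∑ σ : Equiv.Perm α, (squashCard H k (f ∘ σ) : ℝ) = (Fintype.card α).factorial *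
      (((Fintype.card β).choose k : ℝ) / ((Fintype.card α).choose m : ℝ) * H.card) := by
  have hI (I) (hI : I ∈ Finset.powersetCard k (Finset.univ : Finset β)) :
      ((Finset.univ.filter fun σ : Equiv.Perm α =>
        Finset.univ.filter (fun v => f (σ v) ∈ I) ∈ H).card : ℝ) =
        (Fintype.card α).factorial * H.card / (Fintype.card α).choose m := by
    have hA := hf I (Finset.mem_powersetCard.mp hI).2
    have h := card_perm_preimage_mem_mul_choose (Finset.univ.filter fun v => f v ∈ I) H
      (by rwa [hA])
    have hpos : 0 < (Fintype.card α).choose m :=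
      Nat.choose_pos (hA ▸ Finset.card_le_univ _)
    simp only [Finset.mem_filter, Finset.mem_univ, true_and] at h
    rw [hA] at h
    rw [eq_div_iff (by positivity)]
    exact_mod_cast h
  have hswap : ∑ σ : Equiv.Perm α, squashCard H k (f ∘ σ) =
      ∑ I ∈ Finset.powersetCard k (Finset.univ : Finset β),
        (Finset.univ.filter fun σ : Equiv.Perm α =>
          Finset.univ.filter (fun v => f (σ v) ∈ I) ∈ H).card := by
    simp only [squashCard, Finset.card_filter, Function.comp_apply]
    exact Finset.sum_comm
  rw [← Nat.cast_sum, hswap, Nat.cast_sum, Finset.sum_congr rfl hI, Finset.sum_const,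
    Finset.card_powersetCard, Finset.card_univ, nsmul_eq_mul]
  ring

end squashCard


/-- **Lemma (random squashing).** Let `k, n ≥ 1`, `ε > 0` and `q ≥ 2`.  Let `H` be a
`qk`-uniform hypergraph on `qn` vertices, and choose a partition of `V(H)` into `n`
sets of size `q` uniformly at random (encoded as a function `f : V(H) → Fin n` all of
whose fibres have size `q`).  Then with probability at least
`1 - 2·exp(-ε²n/(16q))`, the squashed `k`-graph `H_Q` (with an edge `I` whenever the
union of the fibres over `I` is an edge of `H`) has at least
`(C(n,k)/C(qn,qk))·|E(H)| - ε·n^k` edges. -/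
theorem random_squash (k n q : ℕ) (hk : 1 ≤ k) (hn : 1 ≤ n) (hq : 2 ≤ q)
    (ε : ℝ) (hε : 0 < ε)
    (H : Finset (Finset (Fin (q * n)))) (hH : ∀ e ∈ H, e.card = q * k) :
    (1 - 2 * Real.exp (-(ε ^ 2 * (n : ℝ)) / (16 * (q : ℝ)))) *
        ((Set.ncard {f : Fin (q * n) → Fin n |
            ∀ i : Fin n, (Finset.univ.filter (fun v => f v = i)).card = q}) : ℝ) ≤
      ((Set.ncard {f : Fin (q * n) → Fin n |
          (∀ i : Fin n, (Finset.univ.filter (fun v => f v = i)).card = q) ∧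
          ((n.choose k : ℕ) : ℝ) / (((q * n).choose (q * k) : ℕ) : ℝ) * (H.card : ℝ) -
              ε * (n : ℝ) ^ k ≤
            (((Finset.powersetCard k (Finset.univ : Finset (Fin n))).filter
                (fun I => Finset.univ.filter (fun v => f v ∈ I) ∈ H)).card : ℝ)}) : ℝ) := by
  classical
  have hn0 : (0 : ℝ) < n := by exact_mod_cast hn
  have hq0 : (0 : ℝ) < q := by positivity
  let f₀ : Fin (q * n) → Fin n := fun v => (finProdFinEquiv.symm v).2
  have hf₀ (i : Fin n) : (Finset.univ.filter fun v => f₀ v = i).card = q := by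
    refine (Finset.card_equiv (t := Finset.univ ×ˢ {i}) finProdFinEquiv.symm ?_).trans ?_
    · simp [f₀, eq_comm]
    · simp
  have hf₀' (I : Finset (Fin n)) (hI : I.card = k) :
      (Finset.univ.filter fun v => f₀ v ∈ I).card = q * k := by
    refine (Finset.card_equiv (t := Finset.univ ×ˢ I) finProdFinEquiv.symm ?_).trans ?_
    · simp [f₀]
    · simp [hI]
  set μ : ℝ := ((n.choose k : ℕ) : ℝ) / (((q * n).choose (q * k) : ℕ) : ℝ) * (H.card : ℝ)
  have hμ : ∑ σ : Equiv.Perm (Fin (q * n)), (squashCard H k (f₀ ∘ σ) : ℝ) =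
      (q * n).factorial * μ := by
    simpa using sum_squashCard_comp_perm H k (q * k) f₀ hf₀' hH
  have htail := card_perm_lt_sub_le (q * n) (by positivity)
    (fun σ => (squashCard H k (f₀ ∘ σ) : ℝ)) (2 * (n : ℝ) ^ (k - 1)) (ε * (n : ℝ) ^ k) μ
    (by positivity) (by positivity)
    (fun σ a b => by
      simpa [Function.comp_assoc] using abs_squashCard_comp_swap_sub_le H k (f₀ ∘ σ) a b) hμ
  have hexp : Real.exp (-(ε * (n : ℝ) ^ k) ^ 2 /
      (2 * (q * n : ℕ) * (2 * (n : ℝ) ^ (k - 1)) ^ 2)) ≤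
      2 * Real.exp (-(ε ^ 2 * (n : ℝ)) / (16 * (q : ℝ))) := by
    have h1 : -(ε * (n : ℝ) ^ k) ^ 2 / (2 * (q * n : ℕ) * (2 * (n : ℝ) ^ (k - 1)) ^ 2) =
        2 * (-(ε ^ 2 * (n : ℝ)) / (16 * (q : ℝ))) := by
      obtain ⟨j, rfl⟩ : ∃ j, k = j + 1 := ⟨k - 1, by omega⟩
      rw [Nat.add_sub_cancel]
      push_cast
      field_simp
      ring
    have h2 : -(ε ^ 2 * (n : ℝ)) / (16 * (q : ℝ)) ≤ 0 := by
      rw [neg_div]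
      exact neg_nonpos.mpr (by positivity)
    have h3 := Real.exp_pos (-(ε ^ 2 * (n : ℝ)) / (16 * (q : ℝ)))
    have h4 := Real.exp_le_exp.mpr (by linarith : 2 * (-(ε ^ 2 * (n : ℝ)) / (16 * (q : ℝ))) ≤
      -(ε ^ 2 * (n : ℝ)) / (16 * (q : ℝ)))
    rw [h1]
    linarith
  set S := Finset.univ.filter fun f : Fin (q * n) → Fin n =>
    ∀ i, (Finset.univ.filter fun v => f v = i).card = q
  set K := (Finset.univ.filter fun σ : Equiv.Perm (Fin (q * n)) => f₀ ∘ σ = f₀).card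
  have hK : (0 : ℝ) < K := by
    exact_mod_cast Finset.card_pos.mpr ⟨1, by simp⟩
  have hcount (P : (Fin (q * n) → Fin n) → Prop) :
      (Finset.univ.filter fun σ : Equiv.Perm (Fin (q * n)) => P (f₀ ∘ σ)).card =
        K * (S.filter P).card := by
    rw [card_perm_filter_comp f₀ P]
    simp only [hf₀, S, Finset.filter_filter, K]
  have htotal : (q * n).factorial = K * S.card := by
    simpa [Fintype.card_perm] using hcount fun _ => True
  have hbad := hcount fun f => (squashCard H k f : ℝ) < μ - ε * (n : ℝ) ^ k
  rw [hbad, htotal] at htail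
  push_cast at htail
  rw [mul_assoc, mul_le_mul_iff_right₀ hK] at htail
  have hsplit := Finset.card_filter_add_card_filter_not (s := S)
    fun f => (squashCard H k f : ℝ) < μ - ε * (n : ℝ) ^ k
  simp only [not_lt] at hsplit
  have hS : Set.ncard {f : Fin (q * n) → Fin n |
      ∀ i : Fin n, (Finset.univ.filter (fun v => f v = i)).card = q} = S.card := by
    rw [← Set.ncard_coe_finset]
    congr 1
    ext f
    simp [S]
  have hG : Set.ncard {f : Fin (q * n) → Fin n |
      (∀ i : Fin n, (Finset.univ.filter (fun v => f v = i)).card = q) ∧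
      μ - ε * (n : ℝ) ^ k ≤ (squashCard H k f : ℝ)} =
      (S.filter fun f => μ - ε * (n : ℝ) ^ k ≤ (squashCard H k f : ℝ)).card := by
    rw [← Set.ncard_coe_finset]
    congr 1
    ext f
    simp [S]
  rw [hS]
  refine le_of_le_of_eq ?_ (congrArg Nat.cast hG.symm)
  push_cast at hexp
  have := htail.trans (mul_le_mul_of_nonneg_left hexp (Nat.cast_nonneg S.card))
  rify at hsplit
  linarith
end
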